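/- Let F ⊂ ℝⁿ be a compact convex set of volume 1 and let P be a non-constant polynomial on ℝⁿ of degree at most d. Let M(P) be the unique positive number such that Vol{x ∈ F : |P(x)| ≥ M(P)} = 1/e. Then for every λ > 1, Vol{x ∈ F : |P(x)| > (4λ)^d M(P)} ≤ e^{−λ}. -/

import Mathlib

open MeasureTheory

open Polynomial in
lemma chebyshev_T_eval_nonneg_le {x : ℝ} (hx : 1 ≤ x) (n : ℕ) :
    0 ≤ (Chebyshev.T ℝ n).eval x ∧ (Chebyshev.T ℝ n).eval x ≤ (2 * x) ^ n := by
  have h0 : ∀ m : ℕ, 0 ≤ (Chebyshev.T ℝ m).eval x := fun m =>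
    zero_le_one.trans (Chebyshev.one_le_eval_T_real m hx)
  refine ⟨h0 n, ?_⟩
  induction n with
  | zero => simp
  | succ n ih =>
    have key : (Chebyshev.T ℝ ((n + 1 : ℕ) : ℤ)).eval x ≤ 2 * x * (Chebyshev.T ℝ n).eval x := by
      cases n with
      | zero => simp; linarith
      | succ m =>
        have := Chebyshev.T_add_two ℝ (m : ℤ)
        have h2 : ((m + 1 + 1 : ℕ) : ℤ) = (m : ℤ) + 2 := by push_cast; ring
        rw [h2, this]
        have := h0 m
        simp
        linarith
    rw [pow_succ']
    exact key.trans (mul_le_mul_of_nonneg_left ih (by linarith))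

open Polynomial in
lemma abs_eval_le_mul_chebyshev_T {p : ℝ[X]} {d : ℕ} (hp : p.natDegree ≤ d) {M y L e : ℝ}
    (he : 0 < e) (x ξ : ℕ → ℝ)
    (hξ : ∀ i, ξ i = e * (1 + Chebyshev.node d i) / 2)
    (hx : ∀ i ≤ d, ∀ j ≤ d, |ξ i - ξ j| ≤ |x i - x j|)
    (hy : ∀ i ≤ d, |y - x i| ≤ L - ξ i) (hM : ∀ i ≤ d, |p.eval (x i)| ≤ M) :
    |p.eval y| ≤ M * (Chebyshev.T ℝ d).eval (2 * L / e - 1) := by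
  have hnode : ∀ i ≤ d, ∀ j ≤ d, i ≠ j → Chebyshev.node d i ≠ Chebyshev.node d j := by
    intro i hi j hj hij
    rcases lt_or_gt_of_ne hij with h | h
    · exact (Chebyshev.node_lt hj h).ne'
    · exact (Chebyshev.node_lt hi h).ne
  have hξinj : ∀ i ≤ d, ∀ j ≤ d, i ≠ j → 0 < |ξ i - ξ j| := by
    intro i hi j hj hij
    rw [abs_pos, hξ, hξ, sub_ne_zero]
    intro h
    apply hnode i hi j hj hij
    have : e * Chebyshev.node d i = e * Chebyshev.node d j := by linarith
    exact mul_left_cancel₀ he.ne' this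
  have hle : ∀ i ∈ Finset.range (d + 1), i ≤ d := fun i hi =>
    Nat.lt_succ_iff.mp (Finset.mem_range.mp hi)
  have hxinj : Set.InjOn x (Finset.range (d + 1)) := by
    intro i hi j hj h
    by_contra hij
    have h1 := hξinj i (hle i hi) j (hle j hj) hij
    have h2 := hx i (hle i hi) j (hle j hj)
    rw [h, sub_self, abs_zero] at h2
    linarith
  have hninj : Set.InjOn (Chebyshev.node d) (Finset.range (d + 1)) := by
    intro i hi j hj h
    by_contra hij
    exact hnode i (hle i hi) j (hle j hj) hij h
  have hdeg : ∀ q : ℝ[X], q.natDegree ≤ d → q.degree < (Finset.range (d + 1)).card := by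
    intro q hq
    rw [Finset.card_range]
    exact lt_of_le_of_lt degree_le_natDegree (by exact_mod_cast Nat.lt_succ_of_le hq)
  have hpy : p.eval y = ∑ j ∈ Finset.range (d + 1), p.eval (x j) *
      ∏ i ∈ (Finset.range (d + 1)).erase j, ((y - x i) / (x j - x i)) := by
    conv_lhs => rw [Lagrange.eq_interpolate hxinj (hdeg p hp)]
    simp only [Lagrange.interpolate_apply, eval_finsetSum, eval_mul, eval_C, Lagrange.basis,
      eval_prod, Lagrange.basisDivisor, eval_sub, eval_X]
    refine Finset.sum_congr rfl fun j _ => ?_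
    congr 1
    exact Finset.prod_congr rfl fun i _ => by ring
  set X₀ := 2 * L / e - 1 with hX₀
  have hT : (Chebyshev.T ℝ d).eval X₀ = ∑ j ∈ Finset.range (d + 1),
      ∏ i ∈ (Finset.range (d + 1)).erase j, ((L - ξ i) / |ξ j - ξ i|) := by
    have hTd : (Chebyshev.T ℝ d).natDegree ≤ d := by simp [Chebyshev.natDegree_T]
    conv_lhs => rw [Lagrange.eq_interpolate hninj (hdeg _ hTd)]
    simp only [Lagrange.interpolate_apply, eval_finsetSum, eval_mul, eval_C, Lagrange.basis,
      eval_prod, Lagrange.basisDivisor, eval_sub, eval_X]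
    refine Finset.sum_congr rfl fun j hj => ?_
    rw [Chebyshev.eval_T_real_node (by simpa using hle j hj)]
    have hfac : ∀ i ∈ (Finset.range (d + 1)).erase j, (L - ξ i) / |ξ j - ξ i| =
        (X₀ - Chebyshev.node d i) / |Chebyshev.node d j - Chebyshev.node d i| := by
      intro i hi
      obtain ⟨hij, hi⟩ := Finset.mem_erase.mp hi
      have h1 : ξ j - ξ i = (e / 2) * (Chebyshev.node d j - Chebyshev.node d i) := by
        rw [hξ, hξ]; ring
      have h2 : L - ξ i = (e / 2) * (X₀ - Chebyshev.node d i) := by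
        rw [hξ, hX₀]; field_simp; ring
      rw [h1, h2, abs_mul, abs_of_pos (half_pos he), mul_div_mul_left _ _ (half_pos he).ne']
    rw [Finset.prod_congr rfl hfac, Finset.prod_div_distrib, ← Finset.abs_prod]
    have hpos := Chebyshev.zero_lt_prod_node_sub_node (hle j hj)
    have habs : |∏ i ∈ (Finset.range (d + 1)).erase j,
        (Chebyshev.node d j - Chebyshev.node d i)| = (-1) ^ j *
        ∏ i ∈ (Finset.range (d + 1)).erase j, (Chebyshev.node d j - Chebyshev.node d i) := by
      rw [← abs_of_pos hpos, abs_mul, abs_pow, abs_neg, abs_one, one_pow, one_mul]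
    rw [habs, Finset.prod_mul_distrib, Finset.prod_inv_distrib]
    have hne : (∏ i ∈ (Finset.range (d + 1)).erase j,
        (Chebyshev.node d j - Chebyshev.node d i)) ≠ 0 := by
      intro h; rw [h, mul_zero] at hpos; exact lt_irrefl _ hpos
    rcases neg_one_pow_eq_or ℝ j with h | h <;> rw [h] <;> field_simp
  rw [hpy, hT, Finset.mul_sum]
  refine (Finset.abs_sum_le_sum_abs _ _).trans (Finset.sum_le_sum fun j hj => ?_)
  rw [abs_mul, Finset.abs_prod]
  have hM0 : 0 ≤ M := (abs_nonneg _).trans (hM j (hle j hj))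
  refine mul_le_mul (hM j (hle j hj)) ?_ (Finset.prod_nonneg fun _ _ => abs_nonneg _) hM0
  refine Finset.prod_le_prod (fun _ _ => abs_nonneg _) fun i hi => ?_
  obtain ⟨hij, hi⟩ := Finset.mem_erase.mp hi
  rw [abs_div]
  exact div_le_div₀ ((abs_nonneg _).trans (hy i (hle i hi))) (hy i (hle i hi))
    (hξinj j (hle j hj) i (hle i hi) hij.symm) (hx j (hle j hj) i (hle i hi))

lemma exists_mem_volume_inter_Icc_eq {K : Set ℝ} {x y : ℝ} (hK : IsCompact K)
    (hKxy : K ⊆ Set.Icc x y) (hne : K.Nonempty) {ξ : ℝ} (h0 : 0 ≤ ξ) (h1 : ξ ≤ volume.real K) :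
    ∃ u ∈ K, volume.real (K ∩ Set.Icc x u) = ξ := by
  have hfin : ∀ u, volume (K ∩ Set.Icc x u) ≠ ⊤ := fun u =>
    ((measure_mono Set.inter_subset_left).trans_lt hK.measure_lt_top).ne
  set g : ℝ → ℝ := fun u => volume.real (K ∩ Set.Icc x u) with hg
  have hmono : Monotone g := fun u v huv => measureReal_mono
    (Set.inter_subset_inter_right _ (Set.Icc_subset_Icc_right huv)) (hfin v)
  have hsub : ∀ u v, u ≤ v → g v ≤ g u + (v - u) := by
    intro u v huv
    have : K ∩ Set.Icc x v ⊆ (K ∩ Set.Icc x u) ∪ Set.Icc u v := by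
      rintro z ⟨hz, hz1, hz2⟩
      rcases le_total z u with h | h
      · exact Or.inl ⟨hz, hz1, h⟩
      · exact Or.inr ⟨h, hz2⟩
    refine (measureReal_mono this ?_).trans ((measureReal_union_le _ _).trans ?_)
    · exact ((measure_union_le _ _).trans_lt (ENNReal.add_lt_top.mpr
        ⟨(hfin u).lt_top, measure_Icc_lt_top⟩)).ne
    · simp [Real.volume_real_Icc_of_le huv, hg]
  have hcont : Continuous g := by
    refine (LipschitzWith.of_dist_le_mul (K := 1) fun u v => ?_).continuous
    rw [Real.dist_eq, Real.dist_eq, NNReal.coe_one, one_mul]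
    rcases le_total u v with h | h
    · rw [abs_sub_comm, abs_sub_comm u, abs_of_nonneg (sub_nonneg.mpr (hmono h)),
        abs_of_nonneg (sub_nonneg.mpr h)]
      linarith [hsub u v h]
    · rw [abs_of_nonneg (sub_nonneg.mpr (hmono h)), abs_of_nonneg (sub_nonneg.mpr h)]
      linarith [hsub v u h]
  have hxy : x ≤ y := by
    obtain ⟨z, hz⟩ := hne
    exact (hKxy hz).1.trans (hKxy hz).2
  have hgx : g x ≤ 0 := by
    refine (measureReal_mono Set.inter_subset_right ?_).trans (by simp [measureReal_def])
    simp
  have hgy : g y = volume.real K := by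
    simp only [hg]; rw [Set.inter_eq_left.mpr hKxy]
  obtain ⟨c, hc, hgc⟩ : ξ ∈ g '' Set.Icc x y :=
    intermediate_value_Icc hxy hcont.continuousOn ⟨hgx.trans h0, by rw [hgy]; exact h1⟩
  by_cases hKc : (K ∩ Set.Icc x c).Nonempty
  · obtain ⟨u, hu, hmax⟩ := (hK.inter_right isClosed_Icc).exists_isGreatest hKc
    refine ⟨u, hu.1, ?_⟩
    have : K ∩ Set.Icc x u = K ∩ Set.Icc x c := by
      ext z
      constructor
      · rintro ⟨hz, hz1, hz2⟩
        exact ⟨hz, hz1, hz2.trans hu.2.2⟩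
      · rintro hz
        exact ⟨hz.1, hz.2.1, hmax hz⟩
    rw [this]; exact hgc
  · obtain ⟨u, hu, hmin⟩ := hK.exists_isLeast hne
    refine ⟨u, hu, ?_⟩
    rw [Set.not_nonempty_iff_eq_empty] at hKc
    have hξ : ξ = 0 := by rw [← hgc]; simp only [hg]; rw [hKc]; simp
    have : K ∩ Set.Icc x u ⊆ {u} := fun z hz => le_antisymm hz.2.2 (hmin hz.1)
    rw [hξ]
    refine le_antisymm ((measureReal_mono this (by simp)).trans (by simp [measureReal_def]))
      measureReal_nonneg

open Polynomial in
lemma remez_right {p : ℝ[X]} {d : ℕ} (hp : p.natDegree ≤ d) (hd : 0 < d) {M lam x y : ℝ}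
    (hM : 0 < M) (hlam : 1 ≤ lam) (hxy : x ≤ y) (hy : (4 * lam) ^ d * M ≤ |p.eval y|) :
    lam * volume.real ({z | |p.eval z| < M} ∩ Set.Icc x y) ≤ y - x := by
  by_contra! hlt
  set K : Set ℝ := {z | |p.eval z| ≤ M} ∩ Set.Icc x y with hKdef
  have hK : IsCompact K := isCompact_Icc.inter_left
    (isClosed_le (p.continuous.abs) continuous_const)
  set e := volume.real K with he
  have hEK : volume.real ({z | |p.eval z| < M} ∩ Set.Icc x y) ≤ e :=
    measureReal_mono (Set.inter_subset_inter_left _ fun z (hz : |p.eval z| < M) => hz.le)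
      hK.measure_lt_top.ne
  have hlam0 : 0 < lam := by linarith
  have heL : y - x < lam * e := hlt.trans_le (mul_le_mul_of_nonneg_left hEK hlam0.le)
  have he0 : 0 < e := by
    by_contra! h
    nlinarith
  have hKle : ∀ u v, u ≤ v → volume.real (K ∩ Set.Icc u v) ≤ v - u := fun u v huv =>
    (measureReal_mono Set.inter_subset_right measure_Icc_lt_top.ne).trans
      (Real.volume_real_Icc_of_le huv).le
  have heL' : e ≤ y - x := by
    have := hKle x y hxy
    rwa [Set.inter_eq_left.mpr Set.inter_subset_right] at this
  have hKne : K.Nonempty := by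
    by_contra h
    rw [Set.not_nonempty_iff_eq_empty] at h
    rw [he, h] at he0
    simp at he0
  have hnode : ∀ i, Chebyshev.node d i ∈ Set.Icc (-1 : ℝ) 1 := fun i => Chebyshev.node_mem_Icc
  have hex : ∀ i : ℕ, ∃ u ∈ K, volume.real (K ∩ Set.Icc x u) =
      e * (1 + Chebyshev.node d i) / 2 := by
    intro i
    have := hnode i
    refine exists_mem_volume_inter_Icc_eq hK Set.inter_subset_right hKne ?_ ?_
    · have : 0 ≤ 1 + Chebyshev.node d i := by linarith [this.1]
      positivity
    · rw [← he]; nlinarith [this.2]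
  choose u huK hu using hex
  have hgsub : ∀ a b, x ≤ a → a ≤ b →
      volume.real (K ∩ Set.Icc x b) ≤ volume.real (K ∩ Set.Icc x a) + (b - a) ∧
      volume.real (K ∩ Set.Icc x a) ≤ volume.real (K ∩ Set.Icc x b) := by
    intro a b hxa hab
    have hfin : ∀ c, volume (K ∩ Set.Icc x c) ≠ ⊤ := fun c =>
      ((measure_mono Set.inter_subset_left).trans_lt hK.measure_lt_top).ne
    refine ⟨?_, measureReal_mono
      (Set.inter_subset_inter_right _ (Set.Icc_subset_Icc_right hab)) (hfin b)⟩
    have h1 : K ∩ Set.Icc x b = (K ∩ Set.Icc x a) ∪ (K ∩ Set.Icc a b) := by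
      rw [← Set.inter_union_distrib_left, Set.Icc_union_Icc_eq_Icc hxa hab]
    rw [h1]
    refine (measureReal_union_le _ _).trans ?_
    linarith [hKle a b hab]
  have hbound : |p.eval y| ≤ M * (Chebyshev.T ℝ d).eval (2 * (y - x) / e - 1) := by
    refine abs_eval_le_mul_chebyshev_T hp he0 u
      (fun i => e * (1 + Chebyshev.node d i) / 2) (fun i => rfl) ?_ ?_ fun i _ => (huK i).1
    · intro i _ j _
      rw [← hu i, ← hu j]
      rcases le_total (u i) (u j) with h | h
      · obtain ⟨h1, h2⟩ := hgsub _ _ (huK i).2.1 h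
        rw [abs_le]
        rw [abs_of_nonpos (sub_nonpos.mpr h)]
        constructor <;> linarith
      · obtain ⟨h1, h2⟩ := hgsub _ _ (huK j).2.1 h
        rw [abs_le]
        rw [abs_of_nonneg (sub_nonneg.mpr h)]
        constructor <;> linarith
    · intro i _
      rw [← hu i, abs_of_nonneg (sub_nonneg.mpr (huK i).2.2)]
      linarith [hKle x (u i) (huK i).2.1]
  have hX : 1 ≤ 2 * (y - x) / e - 1 := by
    have : 2 ≤ 2 * (y - x) / e := by rw [le_div_iff₀ he0]; linarith
    linarith
  have h3 : M * (Chebyshev.T ℝ d).eval (2 * (y - x) / e - 1) ≤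
      M * (2 * (2 * (y - x) / e - 1)) ^ d :=
    mul_le_mul_of_nonneg_left (chebyshev_T_eval_nonneg_le hX d).2 hM.le
  have h4 : 2 * (2 * (y - x) / e - 1) < 4 * lam := by
    have : (y - x) / e < lam := by rw [div_lt_iff₀ he0]; exact heL
    have h5 : 2 * (y - x) / e = 2 * ((y - x) / e) := by ring
    rw [h5]; linarith
  have h6 : (2 * (2 * (y - x) / e - 1)) ^ d < (4 * lam) ^ d :=
    pow_lt_pow_left₀ h4 (by linarith) hd.ne'
  nlinarith [mul_lt_mul_of_pos_left h6 hM]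

open Polynomial in
/-- One-sided Remez inequality: between any point and a point where a polynomial is large, the
polynomial is small only on a set of small measure. -/
lemma remez {p : ℝ[X]} {d : ℕ} (hp : p.natDegree ≤ d) (hd : 0 < d) {M lam y : ℝ}
    (hM : 0 < M) (hlam : 1 ≤ lam) (hy : (4 * lam) ^ d * M ≤ |p.eval y|) (x : ℝ) :
    lam * volume.real ({z | |p.eval z| < M} ∩ Set.uIcc x y) ≤ |y - x| := by
  rcases le_total x y with hxy | hxy
  · rw [Set.uIcc_of_le hxy, abs_of_nonneg (sub_nonneg.mpr hxy)]
    exact remez_right hp hd hM hlam hxy hy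
  · have h := remez_right (p := p.comp (-X)) (d := d) (x := -x) (y := -y)
      (by rw [natDegree_comp, natDegree_neg, natDegree_X, mul_one]; exact hp) hd hM hlam
      (neg_le_neg hxy) (by simpa using hy)
    rw [Set.uIcc_of_ge hxy, abs_of_nonpos (sub_nonpos.mpr hxy)]
    have hset : {z | |(p.comp (-X)).eval z| < M} ∩ Set.Icc (-x) (-y) =
        Neg.neg ⁻¹' ({z | |p.eval z| < M} ∩ Set.Icc y x) := by
      ext z
      simp only [eval_comp, eval_neg, eval_X, Set.mem_inter_iff, Set.mem_ofPred_eq, Set.mem_Icc,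
        Set.mem_preimage]
      constructor <;> rintro ⟨h1, h2, h3⟩ <;> exact ⟨h1, by linarith, by linarith⟩
    rw [hset, measureReal_def, Set.neg_preimage, Measure.measure_neg, ← measureReal_def] at h
    linarith

lemma volume_convexCombo_le_of_isCompact {A B C : Set ℝ} (hA : IsCompact A) (hB : IsCompact B)
    (hA0 : A.Nonempty) (hB0 : B.Nonempty) {t : ℝ} (ht0 : 0 ≤ t) (ht1 : t ≤ 1)
    (hC : ∀ x ∈ A, ∀ y ∈ B, (1 - t) * x + t * y ∈ C) :
    ENNReal.ofReal (1 - t) * volume A + ENNReal.ofReal t * volume B ≤ volume C := by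
  obtain ⟨a, haA, ha⟩ := hA.exists_isGreatest hA0
  obtain ⟨b, hbB, hb⟩ := hB.exists_isLeast hB0
  have h1 := Measure.addHaar_image_homothety (volume : Measure ℝ) b (1 - t) A
  have h2 := Measure.addHaar_image_homothety (volume : Measure ℝ) a t B
  rw [Module.finrank_self, pow_one, abs_of_nonneg (sub_nonneg.mpr ht1)] at h1
  rw [Module.finrank_self, pow_one, abs_of_nonneg ht0] at h2
  rw [← h1, ← h2]
  have hmeas : MeasurableSet (AffineMap.homothety a t '' B) :=
    (hB.image (AffineMap.homothety_continuous a t)).measurableSet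
  have hdisj : AEDisjoint volume (AffineMap.homothety b (1 - t) '' A)
      (AffineMap.homothety a t '' B) := by
    refine measure_mono_null (t := {(1 - t) * a + t * b}) ?_ (by simp)
    rintro z ⟨⟨x, hx, rfl⟩, ⟨y, hy, hxy⟩⟩
    simp only [AffineMap.homothety_apply, vsub_eq_sub, vadd_eq_add, smul_eq_mul] at hxy ⊢
    have := mul_le_mul_of_nonneg_left (ha hx) (sub_nonneg.mpr ht1)
    have := mul_le_mul_of_nonneg_left (hb hy) ht0
    rw [Set.mem_singleton_iff]
    linarith
  rw [← measure_union₀ hmeas.nullMeasurableSet hdisj]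
  refine measure_mono ?_
  rintro z (⟨x, hx, rfl⟩ | ⟨y, hy, rfl⟩)
  · have := hC x hx b hbB
    convert this using 1
    simp only [AffineMap.homothety_apply, vsub_eq_sub, vadd_eq_add, smul_eq_mul]
    ring
  · have := hC a haA y hy
    convert this using 1
    simp only [AffineMap.homothety_apply, vsub_eq_sub, vadd_eq_add, smul_eq_mul]
    ring

lemma volume_eq_iSup_isCompact_subtype {A : Set ℝ} (hA : MeasurableSet A) :
    volume A = ⨆ K : {K : Set ℝ // K ⊆ A ∧ IsCompact K}, volume K.1 := by
  refine le_antisymm ?_ (iSup_le fun K => measure_mono K.2.1)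
  rw [hA.measure_eq_iSup_isCompact volume]
  exact iSup_le fun K => iSup_le fun h1 => iSup_le fun h2 =>
    le_iSup (fun K : {K : Set ℝ // K ⊆ A ∧ IsCompact K} => volume K.1) ⟨K, h1, h2⟩

/-- One-dimensional Brunn–Minkowski inequality. -/
lemma volume_convexCombo_le {A B C : Set ℝ} (hA : MeasurableSet A) (hB : MeasurableSet B)
    (hA0 : A.Nonempty) (hB0 : B.Nonempty) {t : ℝ} (ht0 : 0 ≤ t) (ht1 : t ≤ 1)
    (hC : ∀ x ∈ A, ∀ y ∈ B, (1 - t) * x + t * y ∈ C) :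
    ENNReal.ofReal (1 - t) * volume A + ENNReal.ofReal t * volume B ≤ volume C := by
  obtain ⟨a, ha⟩ := hA0
  obtain ⟨b, hb⟩ := hB0
  rw [volume_eq_iSup_isCompact_subtype hA, volume_eq_iSup_isCompact_subtype hB, ENNReal.mul_iSup,
    ENNReal.mul_iSup]
  have : Nonempty {K : Set ℝ // K ⊆ A ∧ IsCompact K} := ⟨⟨∅, by simp, isCompact_empty⟩⟩
  have : Nonempty {K : Set ℝ // K ⊆ B ∧ IsCompact K} := ⟨⟨∅, by simp, isCompact_empty⟩⟩
  refine ENNReal.iSup_add_iSup_le fun K L => ?_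
  have h := volume_convexCombo_le_of_isCompact (K.2.2.insert a) (L.2.2.insert b)
    (Set.insert_nonempty _ _) (Set.insert_nonempty _ _) ht0 ht1 (C := C) fun x hx y hy =>
      hC x (Set.insert_subset ha K.2.1 hx) y (Set.insert_subset hb L.2.1 hy)
  refine le_trans ?_ h
  gcongr <;> exact Set.subset_insert _ _

/-- One-dimensional Prékopa–Leindler inequality. -/
lemma integral_rpow_mul_integral_rpow_le {f g h : ℝ → ℝ} (hf : Integrable f) (hg : Integrable g)
    (hh : Integrable h) (hfm : Measurable f) (hgm : Measurable g) (hf0 : ∀ x, 0 ≤ f x)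
    (hg0 : ∀ x, 0 ≤ g x) (hh0 : ∀ x, 0 ≤ h x) (hfb : BddAbove (Set.range f))
    (hgb : BddAbove (Set.range g)) {t : ℝ} (ht0 : 0 < t) (ht1 : t < 1)
    (H : ∀ x y, f x ^ (1 - t) * g y ^ t ≤ h ((1 - t) * x + t * y)) :
    (∫ x, f x) ^ (1 - t) * (∫ x, g x) ^ t ≤ ∫ x, h x := by
  have hh' : 0 ≤ ∫ x, h x := integral_nonneg hh0
  have ht1' : 0 < 1 - t := sub_pos.mpr ht1
  set F := ⨆ x, f x with hF
  set G := ⨆ x, g x with hG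
  have hfF : ∀ x, f x ≤ F := fun x => le_ciSup hfb x
  have hgG : ∀ x, g x ≤ G := fun x => le_ciSup hgb x
  rcases (hf0 0 |>.trans (hfF 0)).eq_or_lt with hF0 | hF0
  · have : ∀ x, f x = 0 := fun x => le_antisymm (by rw [hF0]; exact hfF x) (hf0 x)
    simp only [this, integral_zero, Real.zero_rpow ht1'.ne', zero_mul, hh']
  rcases (hg0 0 |>.trans (hgG 0)).eq_or_lt with hG0 | hG0
  · have : ∀ x, g x = 0 := fun x => le_antisymm (by rw [hG0]; exact hgG x) (hg0 x)
    simp only [this, integral_zero, Real.zero_rpow ht0.ne', mul_zero, hh']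
  set W := F ^ (1 - t) * G ^ t with hW
  have hW0 : 0 < W := by positivity
  have level : ∀ s ∈ Set.Ioi (0 : ℝ), ENNReal.ofReal (1 - t) * volume {x | s < f x / F} +
      ENNReal.ofReal t * volume {x | s < g x / G} ≤ volume {x | s < h x / W} := by
    intro s hs
    rw [Set.mem_Ioi] at hs
    rcases le_or_gt 1 s with hs1 | hs1
    · have e1 : {x | s < f x / F} = ∅ := by
        rw [Set.eq_empty_iff_forall_notMem]
        intro x (hx : s < f x / F)
        have : f x / F ≤ 1 := (div_le_one hF0).mpr (hfF x)
        linarith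
      have e2 : {x | s < g x / G} = ∅ := by
        rw [Set.eq_empty_iff_forall_notMem]
        intro x (hx : s < g x / G)
        have : g x / G ≤ 1 := (div_le_one hG0).mpr (hgG x)
        linarith
      rw [e1, e2]
      simp
    · refine volume_convexCombo_le (measurableSet_lt measurable_const (hfm.div_const _))
        (measurableSet_lt measurable_const (hgm.div_const _)) ?_ ?_ ht0.le ht1.le ?_
      · obtain ⟨x, hx⟩ := exists_lt_of_lt_ciSup (show s * F < ⨆ x, f x by rw [← hF]; nlinarith)
        exact ⟨x, (lt_div_iff₀ hF0).mpr hx⟩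
      · obtain ⟨x, hx⟩ := exists_lt_of_lt_ciSup (show s * G < ⨆ x, g x by rw [← hG]; nlinarith)
        exact ⟨x, (lt_div_iff₀ hG0).mpr hx⟩
      · intro x (hx : s < f x / F) y (hy : s < g y / G)
        change s < h _ / W
        rw [lt_div_iff₀ hF0] at hx
        rw [lt_div_iff₀ hG0] at hy
        rw [lt_div_iff₀ hW0]
        refine lt_of_lt_of_le ?_ (H x y)
        calc s * W = (s * F) ^ (1 - t) * (s * G) ^ t := by
              rw [Real.mul_rpow hs.le hF0.le, Real.mul_rpow hs.le hG0.le, hW]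
              have : s = s ^ (1 - t) * s ^ t := by
                rw [← Real.rpow_add hs]; simp
              conv_lhs => rw [this]
              ring
          _ < f x ^ (1 - t) * g y ^ t := by
              have hsF := mul_pos hs hF0
              have hsG := mul_pos hs hG0
              exact mul_lt_mul'' (Real.rpow_lt_rpow hsF.le hx ht1')
                (Real.rpow_lt_rpow hsG.le hy ht0) (by positivity) (by positivity)
  have layer : ∀ (k : ℝ → ℝ) (c : ℝ), Integrable k → (∀ x, 0 ≤ k x) → 0 < c →
      ENNReal.ofReal ((∫ x, k x) / c) = ∫⁻ s in Set.Ioi 0, volume {x | s < k x / c} := by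
    intro k c hk hk0 hc
    rw [← integral_div, ofReal_integral_eq_lintegral_ofReal (hk.div_const c)
      (Filter.Eventually.of_forall fun x => div_nonneg (hk0 x) hc.le)]
    exact lintegral_eq_lintegral_meas_lt _
      (Filter.Eventually.of_forall fun x => div_nonneg (hk0 x) hc.le)
      (hk.div_const c).aemeasurable
  have hmono : ∀ k : ℝ → ℝ, Measurable fun s : ℝ => volume {x | s < k x} := fun k =>
    Antitone.measurable fun a b hab => measure_mono fun x (hx : b < k x) => hab.trans_lt hx
  have key : ENNReal.ofReal (1 - t) * ENNReal.ofReal ((∫ x, f x) / F) +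
      ENNReal.ofReal t * ENNReal.ofReal ((∫ x, g x) / G) ≤ ENNReal.ofReal ((∫ x, h x) / W) := by
    rw [layer f F hf hf0 hF0, layer g G hg hg0 hG0, layer h W hh hh0 hW0,
      ← lintegral_const_mul _ (hmono _), ← lintegral_const_mul _ (hmono _),
      ← lintegral_add_left ((hmono _).const_mul _)]
    exact setLIntegral_mono (hmono _) level
  have hIf : 0 ≤ (∫ x, f x) / F := div_nonneg (integral_nonneg hf0) hF0.le
  have hIg : 0 ≤ (∫ x, g x) / G := div_nonneg (integral_nonneg hg0) hG0.le
  have hIh : 0 ≤ (∫ x, h x) / W := div_nonneg hh' hW0.le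
  rw [← ENNReal.ofReal_mul ht1'.le, ← ENNReal.ofReal_mul ht0.le,
    ← ENNReal.ofReal_add (mul_nonneg ht1'.le hIf) (mul_nonneg ht0.le hIg),
    ENNReal.ofReal_le_ofReal_iff hIh] at key
  have amgm := (Real.geom_mean_le_arith_mean2_weighted ht1'.le ht0.le hIf hIg (by ring)).trans key
  rw [le_div_iff₀ hW0] at amgm
  refine le_trans (le_of_eq ?_) amgm
  rw [Real.div_rpow (integral_nonneg hf0) hF0.le, Real.div_rpow (integral_nonneg hg0) hG0.le, hW]
  field_simp

/-- A bounded measurable log-concave function with bounded support. -/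
structure IsLogConcaveProfile (f : ℝ → ℝ) : Prop where
  measurable : Measurable f
  nonneg : ∀ x, 0 ≤ f x
  bounded : ∃ C, ∀ x, f x ≤ C
  support : ∃ R, ∀ x, R < |x| → f x = 0
  logConcave : ∀ x y t, 0 < t → t < 1 → f x ^ (1 - t) * f y ^ t ≤ f ((1 - t) * x + t * y)

/-- The slice of `A` on which the `i`-th coordinate equals `x`. -/
def coordSlice {k : ℕ} (i : Fin (k + 1)) (A : Set (Fin (k + 1) → ℝ)) (x : ℝ) :
    Set (Fin k → ℝ) :=
  {y | (i.insertNth x y : Fin (k + 1) → ℝ) ∈ A}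

section coordSlice

variable {k : ℕ} {A : Set (Fin (k + 1) → ℝ)}

lemma coordSlice_subset_closedBall {R : ℝ} (hR : A ⊆ Metric.closedBall 0 R) (i : Fin (k + 1))
    (x : ℝ) : coordSlice i A x ⊆ Metric.closedBall 0 R := by
  intro y hy
  have h := hR hy
  rw [mem_closedBall_zero_iff] at h ⊢
  have hR0 : 0 ≤ R := (norm_nonneg _).trans h
  rw [pi_norm_le_iff_of_nonneg hR0] at h ⊢
  intro j
  simpa using h (i.succAbove j)

lemma coordSlice_eq_empty {R : ℝ} (hR : A ⊆ Metric.closedBall 0 R) (i : Fin (k + 1))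
    {x : ℝ} (hx : R < |x|) : coordSlice i A x = ∅ := by
  rw [Set.eq_empty_iff_forall_notMem]
  intro y hy
  have h := hR hy
  rw [mem_closedBall_zero_iff] at h
  have h2 := (norm_le_pi_norm _ i).trans h
  simp only [Fin.insertNth_apply_same, Real.norm_eq_abs] at h2
  linarith

lemma isCompact_coordSlice (hA : IsCompact A) (i : Fin (k + 1)) (x : ℝ) :
    IsCompact (coordSlice i A x) := by
  obtain ⟨R, hR⟩ := hA.isBounded.subset_closedBall 0
  refine Metric.isCompact_of_isClosed_isBounded ?_
    (Metric.isBounded_closedBall.subset (coordSlice_subset_closedBall hR i x))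
  exact hA.isClosed.preimage (continuous_const.finInsertNth i continuous_id)

lemma volume_inter_coord_preimage (hA : MeasurableSet A) (i : Fin (k + 1)) {S : Set ℝ}
    (hS : MeasurableSet S) :
    Measurable (fun x => volume (coordSlice i A x)) ∧
      volume (A ∩ {z | z i ∈ S}) = ∫⁻ x in S, volume (coordSlice i A x) := by
  have hmp := (volume_preserving_piFinSuccAbove (fun _ : Fin (k + 1) => ℝ) i).symm
  have hA' := hmp.measurable hA
  constructor
  · exact measurable_measure_prodMk_left hA'
  have hi : MeasurableSet (A ∩ {z : Fin (k + 1) → ℝ | z i ∈ S}) :=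
    hA.inter (measurable_pi_apply i hS)
  rw [← hmp.measure_preimage hi.nullMeasurableSet, Measure.volume_eq_prod,
    Measure.prod_apply (hmp.measurable hi), ← lintegral_indicator hS]
  refine lintegral_congr fun x => ?_
  by_cases hx : x ∈ S
  · rw [Set.indicator_of_mem hx]
    congr 1
    ext y
    simp [coordSlice, hx, Fin.insertNthEquiv]
  · rw [Set.indicator_of_notMem hx]
    convert measure_empty (μ := (volume : Measure (Fin k → ℝ)))
    ext y
    simp [hx]

lemma coordSlice_profile (hA : IsCompact A) (i : Fin (k + 1)) :
    Measurable (fun x => volume.real (coordSlice i A x)) ∧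
    (∃ C, ∀ x, volume.real (coordSlice i A x) ≤ C) ∧
    ∃ R, ∀ x, R < |x| → volume.real (coordSlice i A x) = 0 := by
  obtain ⟨R, hR⟩ := hA.isBounded.subset_closedBall 0
  refine ⟨(volume_inter_coord_preimage hA.measurableSet i
    MeasurableSet.univ).1.ennreal_toReal,
    ⟨volume.real (Metric.closedBall (0 : Fin k → ℝ) R), fun x => ?_⟩, R, fun x hx => ?_⟩
  · exact measureReal_mono (coordSlice_subset_closedBall hR i x)
      (isCompact_closedBall _ _).measure_lt_top.ne
  · rw [coordSlice_eq_empty hR i hx]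
    simp

end coordSlice

lemma integrable_of_bounded_support {f : ℝ → ℝ} (hm : Measurable f) (h0 : ∀ x, 0 ≤ f x)
    (hb : ∃ C, ∀ x, f x ≤ C) (hs : ∃ R, ∀ x, R < |x| → f x = 0) : Integrable f := by
  obtain ⟨C, hC⟩ := hb
  obtain ⟨R, hR⟩ := hs
  have : IntegrableOn f (Set.Icc (-R) R) := by
    refine Measure.integrableOn_of_bounded (M := C) measure_Icc_lt_top.ne
      hm.aestronglyMeasurable (Filter.Eventually.of_forall fun x => ?_)
    rw [Real.norm_of_nonneg (h0 x)]
    exact hC x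
  refine this.integrable_of_forall_notMem_eq_zero fun x hx => hR x ?_
  by_contra! h
  exact hx (abs_le.mp h)

lemma integral_coordSlice {k : ℕ} {A : Set (Fin (k + 1) → ℝ)} (hA : IsCompact A)
    (i : Fin (k + 1)) {S : Set ℝ} (hS : MeasurableSet S) :
    volume.real (A ∩ {z | z i ∈ S}) = ∫ x in S, volume.real (coordSlice i A x) := by
  obtain ⟨hm, hb, hs⟩ := coordSlice_profile hA i
  have hint := integrable_of_bounded_support hm (fun x => measureReal_nonneg) hb hs
  rw [integral_eq_lintegral_of_nonneg_ae (Filter.Eventually.of_forall fun x => measureReal_nonneg)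
    hm.aestronglyMeasurable, measureReal_def,
    (volume_inter_coord_preimage hA.measurableSet i hS).2]
  congr 1
  refine lintegral_congr fun x => ?_
  rw [ofReal_measureReal (isCompact_coordSlice hA i x).measure_lt_top.ne]

/-- Multiplicative Brunn–Minkowski inequality for compact sets. -/
lemma volume_rpow_mul_volume_rpow_le {n : ℕ} {A B C : Set (Fin n → ℝ)} (hA : IsCompact A)
    (hB : IsCompact B) (hC : IsCompact C) {t : ℝ} (ht0 : 0 < t) (ht1 : t < 1)
    (H : ∀ x ∈ A, ∀ y ∈ B, (1 - t) • x + t • y ∈ C) :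
    volume.real A ^ (1 - t) * volume.real B ^ t ≤ volume.real C := by
  have ht1' : 0 < 1 - t := sub_pos.mpr ht1
  induction n with
  | zero =>
    rcases A.eq_empty_or_nonempty with rfl | hA0
    · simp [Real.zero_rpow ht1'.ne']
    rcases B.eq_empty_or_nonempty with rfl | hB0
    · simp [Real.zero_rpow ht0.ne']
    have hC0 : C.Nonempty := by
      obtain ⟨a, ha⟩ := hA0
      obtain ⟨b, hb⟩ := hB0
      exact ⟨_, H a ha b hb⟩
    rw [Subsingleton.eq_univ_of_nonempty hA0, Subsingleton.eq_univ_of_nonempty hB0,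
      Subsingleton.eq_univ_of_nonempty hC0]
    have : volume.real (Set.univ : Set (Fin 0 → ℝ)) = 1 := by
      simp [measureReal_def, volume_pi]
    simp [this]
  | succ k ih =>
    have hfull : ∀ {D : Set (Fin (k + 1) → ℝ)}, IsCompact D →
        volume.real D = ∫ x, volume.real (coordSlice 0 D x) := by
      intro D hD
      have := integral_coordSlice hD 0 MeasurableSet.univ
      simpa using this
    have hprof : ∀ {D : Set (Fin (k + 1) → ℝ)}, IsCompact D → _ := fun hD =>
      coordSlice_profile hD 0
    have hbdd : ∀ {D : Set (Fin (k + 1) → ℝ)}, IsCompact D →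
        BddAbove (Set.range fun x => volume.real (coordSlice 0 D x)) := by
      intro D hD
      obtain ⟨c, hc⟩ := (hprof hD).2.1
      exact ⟨c, by rintro _ ⟨x, rfl⟩; exact hc x⟩
    have hint : ∀ {D : Set (Fin (k + 1) → ℝ)}, IsCompact D →
        Integrable fun x => volume.real (coordSlice 0 D x) := fun hD =>
      integrable_of_bounded_support (hprof hD).1 (fun x => measureReal_nonneg) (hprof hD).2.1
        (hprof hD).2.2
    rw [hfull hA, hfull hB, hfull hC]
    refine integral_rpow_mul_integral_rpow_le (hint hA) (hint hB) (hint hC) (hprof hA).1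
      (hprof hB).1 (fun x => measureReal_nonneg) (fun x => measureReal_nonneg)
      (fun x => measureReal_nonneg) (hbdd hA) (hbdd hB) ht0 ht1 fun x y => ?_
    refine ih (isCompact_coordSlice hA 0 x) (isCompact_coordSlice hB 0 y)
      (isCompact_coordSlice hC 0 _) fun u hu v hv => ?_
    have := H _ hu _ hv
    have h2 : (1 - t) • (Fin.insertNth 0 x u : Fin (k + 1) → ℝ) + t • Fin.insertNth 0 y v =
        Fin.insertNth 0 ((1 - t) * x + t * y) ((1 - t) • u + t • v) := by
      ext j
      refine Fin.cases ?_ (fun j => ?_) j <;> simp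
    rw [h2] at this
    exact this

lemma isLogConcaveProfile_coordSlice {k : ℕ} {K : Set (Fin (k + 1) → ℝ)} (hK : IsCompact K)
    (hconv : Convex ℝ K) (i : Fin (k + 1)) :
    IsLogConcaveProfile fun x => volume.real (coordSlice i K x) := by
  obtain ⟨hm, hb, hs⟩ := coordSlice_profile hK i
  refine ⟨hm, fun x => measureReal_nonneg, hb, hs, fun x y t ht0 ht1 => ?_⟩
  refine volume_rpow_mul_volume_rpow_le (isCompact_coordSlice hK i x)
    (isCompact_coordSlice hK i y) (isCompact_coordSlice hK i _) ht0 ht1 fun u hu v hv => ?_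
  have := hconv hu hv (sub_pos.mpr ht1).le ht0.le (by ring)
  have h2 : (1 - t) • (i.insertNth x u : Fin (k + 1) → ℝ) + t • i.insertNth y v =
      i.insertNth ((1 - t) * x + t * y) ((1 - t) • u + t • v) := by
    ext j
    refine Fin.succAboveCases i ?_ (fun j => ?_) j <;> simp
  rw [h2] at this
  exact this

/-- The measure on the line with density `f`. -/
noncomputable def densityMeasure (f : ℝ → ℝ) : Measure ℝ :=
  volume.withDensity fun x => ENNReal.ofReal (f x)

lemma densityMeasure_neg {f : ℝ → ℝ} (S : Set ℝ) :
    (densityMeasure fun x => f (-x)) S = densityMeasure f (Neg.neg ⁻¹' S) := by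
  rw [densityMeasure, densityMeasure, withDensity_apply' _ S, withDensity_apply' _ (Neg.neg ⁻¹' S)]
  exact ((Measure.measurePreserving_neg (volume : Measure ℝ)).setLIntegral_comp_preimage_emb
    (MeasurableEquiv.neg ℝ).measurableEmbedding (fun x => ENNReal.ofReal (f (-x))) S).symm.trans
    (by simp)

lemma volume_real_inter_Icc_le {E : Set ℝ} {u v : ℝ} (huv : u ≤ v) :
    volume.real (E ∩ Set.Icc u v) ≤ v - u :=
  (measureReal_mono Set.inter_subset_right measure_Icc_lt_top.ne).trans
    (Real.volume_real_Icc_of_le huv).le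

lemma volume_real_inter_Icc_add {E : Set ℝ} (hE : MeasurableSet E) {x u v : ℝ} (hxu : x ≤ u)
    (huv : u ≤ v) :
    volume.real (E ∩ Set.Icc x v) =
      volume.real (E ∩ Set.Icc x u) + volume.real (E ∩ Set.Icc u v) := by
  have hfin : ∀ a b, volume (E ∩ Set.Icc a b) ≠ ⊤ := fun a b =>
    ((measure_mono Set.inter_subset_right).trans_lt measure_Icc_lt_top).ne
  rw [← Set.Icc_union_Icc_eq_Icc hxu huv, Set.inter_union_distrib_left,
    measureReal_union₀ ?_ ?_ (hfin _ _) (hfin _ _)]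
  · exact (hE.inter measurableSet_Icc).nullMeasurableSet
  · refine measure_mono_null (t := {u}) ?_ (by simp)
    rintro z ⟨⟨_, _, h1⟩, ⟨_, h2, _⟩⟩
    exact le_antisymm h1 h2

lemma volume_real_inter_Icc_mono {E : Set ℝ} {x u v : ℝ} (huv : u ≤ v) :
    volume.real (E ∩ Set.Icc x u) ≤ volume.real (E ∩ Set.Icc x v) :=
  measureReal_mono (Set.inter_subset_inter_right _ (Set.Icc_subset_Icc_right huv))
    ((measure_mono Set.inter_subset_right).trans_lt measure_Icc_lt_top).ne

lemma continuous_volume_real_inter_Icc {E : Set ℝ} (x : ℝ) :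
    Continuous fun u => volume.real (E ∩ Set.Icc x u) := by
  have hsub : ∀ u v, u ≤ v →
      volume.real (E ∩ Set.Icc x v) ≤ volume.real (E ∩ Set.Icc x u) + (v - u) := by
    intro u v huv
    have : E ∩ Set.Icc x v ⊆ (E ∩ Set.Icc x u) ∪ Set.Icc u v := by
      rintro z ⟨hz, hz1, hz2⟩
      rcases le_total z u with h | h
      · exact Or.inl ⟨hz, hz1, h⟩
      · exact Or.inr ⟨h, hz2⟩
    refine (measureReal_mono this ?_).trans ((measureReal_union_le _ _).trans ?_)
    · exact ((measure_union_le _ _).trans_lt (ENNReal.add_lt_top.mpr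
        ⟨(measure_mono Set.inter_subset_right).trans_lt measure_Icc_lt_top,
          measure_Icc_lt_top⟩)).ne
    · simp [Real.volume_real_Icc_of_le huv]
  refine (LipschitzWith.of_dist_le_mul (K := 1) fun u v => ?_).continuous
  rw [Real.dist_eq, Real.dist_eq, NNReal.coe_one, one_mul]
  rcases le_total u v with h | h
  · rw [abs_sub_comm, abs_sub_comm u,
      abs_of_nonneg (sub_nonneg.mpr (volume_real_inter_Icc_mono h)),
      abs_of_nonneg (sub_nonneg.mpr h)]
    linarith [hsub u v h]
  · rw [abs_of_nonneg (sub_nonneg.mpr (volume_real_inter_Icc_mono h)),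
      abs_of_nonneg (sub_nonneg.mpr h)]
    linarith [hsub v u h]

namespace IsLogConcaveProfile

variable {f : ℝ → ℝ}

lemma integrable (hf : IsLogConcaveProfile f) : Integrable f :=
  integrable_of_bounded_support hf.measurable hf.nonneg hf.bounded hf.support

lemma isFiniteMeasure (hf : IsLogConcaveProfile f) : IsFiniteMeasure (densityMeasure f) :=
  isFiniteMeasure_withDensity_ofReal hf.integrable.2

lemma real_densityMeasure (hf : IsLogConcaveProfile f) {S : Set ℝ} (hS : MeasurableSet S) :
    (densityMeasure f).real S = ∫ x in S, f x := by
  rw [densityMeasure, measureReal_def, withDensity_apply _ hS,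
    integral_eq_lintegral_of_nonneg_ae (Filter.Eventually.of_forall hf.nonneg)
      hf.measurable.aestronglyMeasurable]

lemma comp_neg (hf : IsLogConcaveProfile f) : IsLogConcaveProfile fun x => f (-x) := by
  refine ⟨hf.measurable.comp measurable_neg, fun x => hf.nonneg _, ?_, ?_, ?_⟩
  · obtain ⟨C, hC⟩ := hf.bounded
    exact ⟨C, fun x => hC _⟩
  · obtain ⟨R, hR⟩ := hf.support
    exact ⟨R, fun x hx => hR _ (by rwa [abs_neg])⟩
  · intro x y t h0 h1
    convert hf.logConcave (-x) (-y) t h0 h1 using 2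
    ring

lemma const_mul (hf : IsLogConcaveProfile f) {c : ℝ} (hc : 0 < c) :
    IsLogConcaveProfile fun x => c * f x := by
  refine ⟨hf.measurable.const_mul c, fun x => mul_nonneg hc.le (hf.nonneg _), ?_, ?_, ?_⟩
  · obtain ⟨C, hC⟩ := hf.bounded
    exact ⟨c * C, fun x => mul_le_mul_of_nonneg_left (hC _) hc.le⟩
  · obtain ⟨R, hR⟩ := hf.support
    exact ⟨R, fun x hx => by rw [hR x hx, mul_zero]⟩
  · intro x y t h0 h1
    rw [Real.mul_rpow hc.le (hf.nonneg _), Real.mul_rpow hc.le (hf.nonneg _)]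
    have : c ^ (1 - t) * c ^ t = c := by rw [← Real.rpow_add hc]; simp
    calc c ^ (1 - t) * f x ^ (1 - t) * (c ^ t * f y ^ t)
        = (c ^ (1 - t) * c ^ t) * (f x ^ (1 - t) * f y ^ t) := by ring
      _ ≤ c * f ((1 - t) * x + t * y) := by
          rw [this]
          exact mul_le_mul_of_nonneg_left (hf.logConcave x y t h0 h1) hc.le

lemma le_of_le_of_le (hf : IsLogConcaveProfile f) {x y z c : ℝ} (hxz : x ≤ z)
    (hzy : z ≤ y) (hx : c ≤ f x) (hy : c ≤ f y) : c ≤ f z := by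
  rcases hxz.eq_or_lt with rfl | hxz
  · exact hx
  rcases hzy.eq_or_lt with rfl | hzy
  · exact hy
  rcases le_or_gt c 0 with hc | hc
  · exact hc.trans (hf.nonneg z)
  have hxy : 0 < y - x := by linarith
  have ht0 : 0 < (z - x) / (y - x) := div_pos (by linarith) hxy
  have ht1 : (z - x) / (y - x) < 1 := by rw [div_lt_one hxy]; linarith
  have h := hf.logConcave x y _ ht0 ht1
  have hz : (1 - (z - x) / (y - x)) * x + (z - x) / (y - x) * y = z := by field_simp; ring
  rw [hz] at h
  refine le_trans ?_ h
  calc c = c ^ (1 - (z - x) / (y - x)) * c ^ ((z - x) / (y - x)) := by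
        rw [← Real.rpow_add hc]; simp
    _ ≤ _ := by
        have := sub_pos.mpr ht1
        gcongr
        exact Real.rpow_nonneg (hf.nonneg _) _

lemma exists_mode (hf : IsLogConcaveProfile f) (h0 : ∃ x, 0 < f x) :
    ∃ θ, MonotoneOn f (Set.Iio θ) ∧ AntitoneOn f (Set.Ioi θ) := by
  obtain ⟨R, hR⟩ := hf.support
  obtain ⟨y₀, hy₀⟩ := h0
  set S : Set ℝ := {x | ∃ y, x < y ∧ f x < f y} with hS
  have hne : S.Nonempty := by
    refine ⟨min (y₀ - 1) (-|R| - 1), y₀, ?_, ?_⟩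
    · exact (min_le_left _ _).trans_lt (by linarith)
    · rw [hR]
      · exact hy₀
      · have h1 : min (y₀ - 1) (-|R| - 1) ≤ -|R| - 1 := min_le_right _ _
        have h2 := abs_nonneg R
        rw [abs_of_neg (by linarith)]
        linarith [le_abs_self R]
  have hbdd : BddAbove S := by
    refine ⟨|R|, ?_⟩
    rintro x ⟨y, hxy, hfxy⟩
    by_contra! hx
    have : f y = 0 := hR y ((le_abs_self R).trans_lt (hx.trans (hxy.trans_le (le_abs_self y))))
    linarith [hf.nonneg x]
  refine ⟨sSup S, ?_, ?_⟩
  · intro x hx x' hx' hxx'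
    obtain ⟨w, ⟨y, hwy, hfwy⟩, hw⟩ := exists_lt_of_lt_csSup hne hx'
    by_contra! hlt
    have h1 : f x ≤ f w := by
      by_contra! h
      have := hf.le_of_le_of_le (c := min (f x) (f y)) (hxx'.trans hw.le) hwy.le
        (min_le_left _ _) (min_le_right _ _)
      rcases min_choice (f x) (f y) with h2 | h2 <;> rw [h2] at this <;> linarith
    have := hf.le_of_le_of_le hxx' hw.le le_rfl h1
    linarith
  · intro x hx y _ hxy
    rcases hxy.eq_or_lt with rfl | hxy
    · exact le_rfl
    by_contra! h
    exact absurd (le_csSup hbdd ⟨y, hxy, h⟩) (not_le.mpr hx)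

/-- The tails of a log-concave measure are log-concave. -/
lemma tail_logConcave (hf : IsLogConcaveProfile f) (x y : ℝ) {t : ℝ} (ht0 : 0 < t) (ht1 : t < 1) :
    (densityMeasure f).real (Set.Ioi x) ^ (1 - t) * (densityMeasure f).real (Set.Ioi y) ^ t ≤
      (densityMeasure f).real (Set.Ioi ((1 - t) * x + t * y)) := by
  have hind : ∀ a, (densityMeasure f).real (Set.Ioi a) = ∫ u, (Set.Ioi a).indicator f u :=
    fun a => by rw [hf.real_densityMeasure measurableSet_Ioi, integral_indicator measurableSet_Ioi]
  have hint : ∀ a, Integrable ((Set.Ioi a).indicator f) := fun a =>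
    hf.integrable.indicator measurableSet_Ioi
  have hmeas : ∀ a, Measurable ((Set.Ioi a).indicator f) := fun a =>
    hf.measurable.indicator measurableSet_Ioi
  have hnn : ∀ a u, 0 ≤ (Set.Ioi a).indicator f u := fun a u =>
    Set.indicator_nonneg (fun v _ => hf.nonneg v) u
  have hbdd : ∀ a, BddAbove (Set.range ((Set.Ioi a).indicator f)) := by
    intro a
    obtain ⟨C, hC⟩ := hf.bounded
    refine ⟨C, ?_⟩
    rintro _ ⟨u, rfl⟩
    refine (Set.indicator_le_self' (fun v _ => hf.nonneg v) u).trans (hC u)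
  rw [hind, hind, hind]
  refine integral_rpow_mul_integral_rpow_le (hint x) (hint y) (hint _) (hmeas x) (hmeas y)
    (hnn x) (hnn y) (hnn _) (hbdd x) (hbdd y) ht0 ht1 fun u v => ?_
  by_cases hu : u ∈ Set.Ioi x
  · by_cases hv : v ∈ Set.Ioi y
    · have hmem : (1 - t) * u + t * v ∈ Set.Ioi ((1 - t) * x + t * y) := by
        rw [Set.mem_Ioi] at *
        nlinarith
      rw [Set.indicator_of_mem hu, Set.indicator_of_mem hv, Set.indicator_of_mem hmem]
      exact hf.logConcave u v t ht0 ht1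
    · rw [Set.indicator_of_notMem hv, Real.zero_rpow ht0.ne', mul_zero]
      exact hnn _ _
  · rw [Set.indicator_of_notMem hu, Real.zero_rpow (sub_pos.mpr ht1).ne', zero_mul]
    exact hnn _ _

end IsLogConcaveProfile

lemma densityMeasure_singleton (f : ℝ → ℝ) (x : ℝ) : densityMeasure f {x} = 0 := by
  rw [densityMeasure, withDensity_apply _ (measurableSet_singleton x)]
  simp

namespace IsLogConcaveProfile

variable {f : ℝ → ℝ}

lemma tail_shift_le (hf : IsLogConcaveProfile f) (hprob : densityMeasure f Set.univ = 1)
    {a b lam x : ℝ} (hlam : 1 < lam) (hab : a ≤ b) (hx : b ≤ x) :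
    (densityMeasure f).real (Set.Ioi (x + (lam - 1) * (b - a))) ≤
      (1 - (densityMeasure f).real (Set.Icc a b)) ^ (lam - 1) *
        (densityMeasure f).real (Set.Ioi x) := by
  have hfin := hf.isFiniteMeasure
  set r : ℝ → ℝ := fun u => (densityMeasure f).real (Set.Ioi u) with hr
  have hrmono : ∀ u v, u ≤ v → r v ≤ r u := fun u v huv =>
    measureReal_mono (Set.Ioi_subset_Ioi huv)
  have hr0 : ∀ u, 0 ≤ r u := fun u => measureReal_nonneg
  have hr1 : ∀ u, r u ≤ 1 := fun u => by
    refine (measureReal_mono (Set.subset_univ _)).trans ?_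
    rw [measureReal_def, hprob]; simp
  have hIcc : (densityMeasure f).real (Set.Icc a b) = r a - r b := by
    have h1 : (densityMeasure f).real (Set.Icc a b) = (densityMeasure f).real (Set.Ioc a b) := by
      rw [← Set.Icc_sdiff_left, measureReal_def, measureReal_def,
        measure_sdiff_null (densityMeasure_singleton f a)]
    rw [h1, hr, ← Set.Ioi_sdiff_Ioi, measureReal_sdiff (Set.Ioi_subset_Ioi hab) measurableSet_Ioi]
  set N := 1 - (densityMeasure f).real (Set.Icc a b) with hN
  rw [hIcc] at hN
  have hN0 : 0 ≤ N := by linarith [hr1 a, hr0 b]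
  change r (x + (lam - 1) * (b - a)) ≤ N ^ (lam - 1) * r x
  rcases hab.eq_or_lt with rfl | hab
  · have : N = 1 := by rw [hN]; ring
    rw [this]
    simp
  set q := x + (lam - 1) * (b - a) with hq
  have hS : 0 < (lam - 1) * (b - a) := mul_pos (by linarith) (by linarith)
  rcases (hr0 q).eq_or_lt with hq0 | hq0
  · rw [← hq0]
    exact mul_nonneg (Real.rpow_nonneg hN0 _) (hr0 x)
  have hxq : x ≤ q := by linarith
  have hxa : a < x := by linarith
  have hra : 0 < r a := hq0.trans_le (hrmono _ _ (by linarith))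
  have hqa : 0 < q - a := by linarith
  have hu0 : 0 < (b - a) / (q - a) := div_pos (by linarith) hqa
  have hu1 : (b - a) / (q - a) < 1 := by rw [div_lt_one hqa]; linarith
  have hw0 : 0 < (x - a) / (q - a) := div_pos (by linarith) hqa
  have hw1 : (x - a) / (q - a) < 1 := by rw [div_lt_one hqa]; linarith
  have h1 := hf.tail_logConcave a q hu0 hu1
  have h2 := hf.tail_logConcave a q hw0 hw1
  have e1 : (1 - (b - a) / (q - a)) * a + (b - a) / (q - a) * q = b := by field_simp; ring
  have e2 : (1 - (x - a) / (q - a)) * a + (x - a) / (q - a) * q = x := by field_simp; ring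
  have e3 : 1 - (x - a) / (q - a) = (b - a) / (q - a) * (lam - 1) := by
    field_simp
    rw [hq]; ring
  rw [e1] at h1
  rw [e2] at h2
  change r a ^ _ * r q ^ _ ≤ r b at h1
  change r a ^ _ * r q ^ _ ≤ r x at h2
  set u := (b - a) / (q - a) with hu
  set w := (x - a) / (q - a) with hw
  have hbN : r b ≤ r a * N := by
    rw [hN]; nlinarith [hrmono a b hab.le, hr1 a]
  have h3 : (r q / r a) ^ u ≤ N := by
    rw [Real.div_rpow hq0.le hra.le, div_le_iff₀ (by positivity)]
    have h4 := h1.trans hbN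
    have h5 : r a ^ (1 - u) * r a ^ u = r a := by rw [← Real.rpow_add hra]; simp
    have h6 : 0 < r a ^ (1 - u) := by positivity
    refine le_of_mul_le_mul_left ?_ h6
    calc r a ^ (1 - u) * r q ^ u ≤ r a * N := h4
      _ = r a ^ (1 - u) * (N * r a ^ u) := by linear_combination -N * h5
  have h7 : (r q / r a) ^ (1 - w) ≤ N ^ (lam - 1) := by
    rw [e3, Real.rpow_mul (by positivity)]
    exact Real.rpow_le_rpow (by positivity) h3 (by linarith)
  have hw' := sub_pos.mpr hw1
  calc r q = (r q / r a) ^ (1 - w) * (r a ^ (1 - w) * r q ^ w) := by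
        rw [Real.div_rpow hq0.le hra.le]
        have h8 : r q ^ (1 - w) * r q ^ w = r q := by rw [← Real.rpow_add hq0]; simp
        have h9 : 0 < r a ^ (1 - w) := by positivity
        field_simp
        rw [mul_comm] at h8
        linarith
    _ ≤ N ^ (lam - 1) * r x := mul_le_mul h7 h2 (by positivity) (Real.rpow_nonneg hN0 _)

/-- Comparison of the masses of sets under a density that is antitone to the right of `θ`. -/
lemma mul_real_le_of_forall_Ioc (hf : IsLogConcaveProfile f) {θ : ℝ}
    (hanti : AntitoneOn f (Set.Ioi θ)) {E S₁ S₂ : Set ℝ} (hE : MeasurableSet E)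
    (hS₁ : MeasurableSet S₁) (hS₂ : MeasurableSet S₂) {c c₁ c₂ : ℝ} (hc : 0 ≤ c) (hc₁ : 0 ≤ c₁)
    (hc₂ : 0 ≤ c₂)
    (H : ∀ x, θ < x → c * volume.real (E ∩ Set.Ioc θ x) ≤
      c₁ * volume.real (S₁ ∩ Set.Ioc θ x) + c₂ * volume.real (S₂ ∩ Set.Ioc θ x)) :
    c * (densityMeasure f).real (E ∩ Set.Ioi θ) ≤
      c₁ * (densityMeasure f).real (S₁ ∩ Set.Ioi θ) +
        c₂ * (densityMeasure f).real (S₂ ∩ Set.Ioi θ) := by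
  have hfin := hf.isFiniteMeasure
  obtain ⟨R, hR⟩ := hf.support
  have hsup : ∀ s : ℝ, 0 < s → ∃ x, ∀ T : Set ℝ,
      volume ({y | s < f y} ∩ (T ∩ Set.Ioi θ)) = volume (T ∩ Set.Ioc θ x) := by
    intro s hs
    set U := {y | s < f y} ∩ Set.Ioi θ with hU
    rcases U.eq_empty_or_nonempty with h | h
    · refine ⟨θ, fun T => ?_⟩
      have : {y | s < f y} ∩ (T ∩ Set.Ioi θ) = T ∩ U := by rw [hU]; ac_rfl
      rw [this, h]
      simp
    have hb : BddAbove U := by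
      refine ⟨|R|, ?_⟩
      rintro y ⟨hy : s < f y, -⟩
      by_contra! hlt
      have := hR y ((le_abs_self R).trans_lt (hlt.trans_le (le_abs_self y)))
      linarith
    refine ⟨sSup U, fun T => measure_congr ?_⟩
    have hUae : U =ᵐ[volume] Set.Ioc θ (sSup U) := by
      have h1 : Set.Ioo θ (sSup U) ⊆ U := by
        rintro y ⟨hy1, hy2⟩
        obtain ⟨w, ⟨hw1, hw2⟩, hw⟩ := exists_lt_of_lt_csSup h hy2
        exact ⟨lt_of_lt_of_le hw1 (hanti hy1 hw2 hw.le), hy1⟩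
      have h2 : U ⊆ Set.Ioc θ (sSup U) := fun y hy => ⟨hy.2, le_csSup hb hy⟩
      refine Filter.EventuallyLE.antisymm h2.eventuallyLE ?_
      exact Ioo_ae_eq_Ioc.symm.le.trans h1.eventuallyLE
    have : {y | s < f y} ∩ (T ∩ Set.Ioi θ) = T ∩ U := by rw [hU]; ac_rfl
    rw [this]
    exact (Filter.EventuallyEq.refl _ T).inter hUae
  have hlayer : ∀ T, MeasurableSet T → densityMeasure f (T ∩ Set.Ioi θ) =
      ∫⁻ s in Set.Ioi 0, volume ({y | s < f y} ∩ (T ∩ Set.Ioi θ)) := by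
    intro T hT
    rw [densityMeasure, withDensity_apply _ (hT.inter measurableSet_Ioi),
      lintegral_eq_lintegral_meas_lt _ (Filter.Eventually.of_forall hf.nonneg)
        hf.measurable.aemeasurable]
    refine lintegral_congr fun s => ?_
    rw [Measure.restrict_apply (measurableSet_lt measurable_const hf.measurable)]
  have hmono : ∀ T : Set ℝ, Measurable fun s : ℝ => volume ({y | s < f y} ∩ (T ∩ Set.Ioi θ)) :=
    fun T => Antitone.measurable fun a b hab =>
      measure_mono (Set.inter_subset_inter_left _ fun x (hx : b < f x) => hab.trans_lt hx)
  have key : ENNReal.ofReal c * densityMeasure f (E ∩ Set.Ioi θ) ≤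
      ENNReal.ofReal c₁ * densityMeasure f (S₁ ∩ Set.Ioi θ) +
        ENNReal.ofReal c₂ * densityMeasure f (S₂ ∩ Set.Ioi θ) := by
    rw [hlayer E hE, hlayer S₁ hS₁, hlayer S₂ hS₂, ← lintegral_const_mul _ (hmono _),
      ← lintegral_const_mul _ (hmono _), ← lintegral_const_mul _ (hmono _),
      ← lintegral_add_left ((hmono _).const_mul _)]
    refine setLIntegral_mono (((hmono _).const_mul _).add ((hmono _).const_mul _)) fun s hs => ?_
    obtain ⟨x, hx⟩ := hsup s hs
    rw [hx, hx, hx]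
    rcases le_or_gt x θ with hxθ | hxθ
    · simp [Set.Ioc_eq_empty (not_lt.mpr hxθ)]
    · have hfi : ∀ T : Set ℝ, volume (T ∩ Set.Ioc θ x) ≠ ⊤ := fun T =>
        ((measure_mono Set.inter_subset_right).trans_lt measure_Ioc_lt_top).ne
      have := ENNReal.ofReal_le_ofReal (H x hxθ)
      rw [ENNReal.ofReal_add (by positivity) (by positivity), ENNReal.ofReal_mul hc,
        ENNReal.ofReal_mul hc₁, ENNReal.ofReal_mul hc₂, ofReal_measureReal (hfi _),
        ofReal_measureReal (hfi _), ofReal_measureReal (hfi _)] at this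
      exact this
  rw [← ofReal_measureReal, ← ofReal_measureReal, ← ofReal_measureReal, ← ENNReal.ofReal_mul hc,
    ← ENNReal.ofReal_mul hc₁, ← ENNReal.ofReal_mul hc₂, ← ENNReal.ofReal_add (by positivity)
    (by positivity), ENNReal.ofReal_le_ofReal_iff (by positivity)] at key
  exact key

end IsLogConcaveProfile

/-- The sets `E` and `B` are in Remez position: between any point and a point of `B` the set `E`
has proportion at most `1 / lam`. -/
structure RemezPosition (lam : ℝ) (E B : Set ℝ) : Prop where
  measurableSet : MeasurableSet E
  isClosed : IsClosed B
  bounded : ∃ R, ∀ x ∈ E, |x| ≤ R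
  mul_le : ∀ y ∈ B, ∀ x, lam * volume.real (E ∩ Set.uIcc x y) ≤ |y - x|
  compl_mem_nhds : ∀ y ∈ B, Eᶜ ∈ nhds y

namespace RemezPosition

variable {lam : ℝ} {E B : Set ℝ}

lemma preimage_neg (h : RemezPosition lam E B) :
    RemezPosition lam (Neg.neg ⁻¹' E) (Neg.neg ⁻¹' B) := by
  refine ⟨measurable_neg h.measurableSet, h.isClosed.preimage continuous_neg, ?_, ?_, ?_⟩
  · obtain ⟨R, hR⟩ := h.bounded
    exact ⟨R, fun x hx => by rw [← abs_neg]; exact hR _ hx⟩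
  · intro y hy x
    have := h.mul_le (-y) hy (-x)
    have hset : Neg.neg ⁻¹' E ∩ Set.uIcc x y = Neg.neg ⁻¹' (E ∩ Set.uIcc (-x) (-y)) := by
      rw [Set.preimage_inter, Set.neg_preimage (s := Set.uIcc _ _), Set.neg_uIcc]
      simp
    rw [hset, measureReal_def, Set.neg_preimage, Measure.measure_neg, ← measureReal_def]
    refine this.trans (le_of_eq ?_)
    rw [← abs_neg]
    congr 1
    ring
  · intro y hy
    exact continuous_neg.continuousAt.preimage_mem_nhds (h.compl_mem_nhds _ hy)

lemma volume_Icc_le_diff (h : RemezPosition lam E B) (hlam : 1 < lam) {q x : ℝ} (hq : q ∈ B)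
    (hqx : q ≤ x) :
    lam * volume.real (E ∩ Set.Icc q x) ≤ volume.real (Bᶜ ∩ Set.Icc q x) := by
  have hlam0 : 0 < lam := by linarith
  set D : ℝ → ℝ := fun x =>
    volume.real (Bᶜ ∩ Set.Icc q x) - lam * volume.real (E ∩ Set.Icc q x) with hD
  have hBm := h.isClosed.measurableSet.compl
  have hDadd : ∀ u v, q ≤ u → u ≤ v → D v = D u + volume.real (Bᶜ ∩ Set.Icc u v) -
      lam * volume.real (E ∩ Set.Icc u v) := by
    intro u v hu huv
    simp only [hD]
    rw [volume_real_inter_Icc_add hBm hu huv, volume_real_inter_Icc_add h.measurableSet hu huv]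
    ring
  have hlast : ∀ v, q ≤ v → ∃ y ∈ B, q ≤ y ∧ y ≤ v ∧ D y ≤ D v := by
    intro v hv
    obtain ⟨y, ⟨hyB, hqy, hyv⟩, hmax⟩ :=
      ((isCompact_Icc (a := q) (b := v)).inter_left h.isClosed).exists_isGreatest
        ⟨q, hq, le_rfl, hv⟩
    refine ⟨y, hyB, hqy, hyv, ?_⟩
    rw [hDadd y v hqy hyv]
    have h1 := h.mul_le y hyB v
    rw [Set.uIcc_of_ge hyv, abs_sub_comm, abs_of_nonneg (sub_nonneg.mpr hyv)] at h1
    have h2 : v - y ≤ volume.real (Bᶜ ∩ Set.Icc y v) := by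
      rw [← Real.volume_real_Ioc_of_le hyv]
      refine measureReal_mono ?_
        ((measure_mono Set.inter_subset_right).trans_lt measure_Icc_lt_top).ne
      rintro z ⟨hz1, hz2⟩
      refine ⟨fun hzB => ?_, hz1.le, hz2⟩
      exact absurd (hmax ⟨hzB, hqy.trans hz1.le, hz2⟩) (not_le.mpr hz1)
    linarith
  suffices ∀ y ∈ B, q ≤ y → 0 ≤ D y by
    obtain ⟨y, hyB, hqy, -, hle⟩ := hlast x hqx
    have := (this y hyB hqy).trans hle
    simp only [hD] at this
    linarith
  by_contra! hneg
  set Z : Set ℝ := {y | y ∈ B ∧ q ≤ y ∧ D y < 0} with hZ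
  have hZne : Z.Nonempty := by
    obtain ⟨y, h1, h2, h3⟩ := hneg
    exact ⟨y, h1, h2, h3⟩
  have hZb : BddBelow Z := ⟨q, fun y hy => hy.2.1⟩
  set m := sInf Z with hm
  have hmB : m ∈ B :=
    h.isClosed.closure_subset_iff.mpr (fun y hy => hy.1) (csInf_mem_closure hZne hZb)
  have hqm : q ≤ m := le_csInf hZne fun y hy => hy.2.1
  obtain ⟨ε, hε, hball⟩ := Metric.mem_nhds_iff.mp (h.compl_mem_nhds m hmB)
  have hnull : ∀ u v, m - ε < u → v < m + ε → volume.real (E ∩ Set.Icc u v) = 0 := by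
    intro u v hu hv
    have : E ∩ Set.Icc u v = ∅ := by
      rw [Set.eq_empty_iff_forall_notMem]
      rintro z ⟨hzE, hz1, hz2⟩
      refine hball ?_ hzE
      rw [Metric.mem_ball, Real.dist_eq, abs_lt]
      constructor <;> linarith
    rw [this]; simp
  obtain ⟨y', hy', hy'lt⟩ := exists_lt_of_csInf_lt hZne (show sInf Z < m + ε by linarith)
  have hmy' : m ≤ y' := csInf_le hZb hy'
  have hDm : D m < 0 := by
    have h1 := hDadd m y' hqm hmy'
    rw [hnull m y' (by linarith) hy'lt] at h1
    have h2 : 0 ≤ volume.real (Bᶜ ∩ Set.Icc m y') := measureReal_nonneg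
    linarith [hy'.2.2]
  have hqm' : q < m := by
    refine lt_of_le_of_ne hqm fun heq => ?_
    rw [← heq] at hDm
    have h1 : volume.real (E ∩ Set.Icc q q) ≤ q - q := volume_real_inter_Icc_le le_rfl
    have h2 : 0 ≤ volume.real (Bᶜ ∩ Set.Icc q q) := measureReal_nonneg
    simp only [hD] at hDm
    nlinarith
  have hwm : max q (m - ε / 2) < m := max_lt hqm' (by linarith)
  have hDw : D (max q (m - ε / 2)) < 0 := by
    have h1 := hDadd _ m (le_max_left q (m - ε / 2)) hwm.le
    rw [hnull _ m (lt_of_lt_of_le (by linarith) (le_max_right _ _)) (by linarith)] at h1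
    have h2 : 0 ≤ volume.real (Bᶜ ∩ Set.Icc (max q (m - ε / 2)) m) := measureReal_nonneg
    linarith
  obtain ⟨y'', hB'', hq'', hle'', hD''⟩ := hlast _ (le_max_left q (m - ε / 2))
  have : m ≤ y'' := csInf_le hZb ⟨hB'', hq'', hD''.trans_lt hDw⟩
  linarith

end RemezPosition

lemma volume_real_inter_Ioc {T : Set ℝ} (u v : ℝ) :
    volume.real (T ∩ Set.Ioc u v) = volume.real (T ∩ Set.Icc u v) := by
  rw [measureReal_def, measureReal_def]
  congr 1
  exact measure_congr ((Filter.EventuallyEq.refl _ T).inter Ioc_ae_eq_Icc)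

lemma densityMeasure_real_Ici {f : ℝ → ℝ} (x : ℝ) :
    (densityMeasure f).real (Set.Ici x) = (densityMeasure f).real (Set.Ioi x) := by
  rw [← Set.Ici_sdiff_left, measureReal_def, measureReal_def,
    measure_sdiff_null (densityMeasure_singleton f x)]

namespace RemezPosition

lemma exists_right_balance {f : ℝ → ℝ} (hf : IsLogConcaveProfile f) {lam : ℝ} {E B : Set ℝ}
    (h : RemezPosition lam E B) (hlam : 1 < lam) {θ s t p₀ q₀ z : ℝ}
    (hanti : AntitoneOn f (Set.Ioi θ)) (hp₀ : p₀ ≤ θ) (hq₀ : θ ≤ q₀)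
    (hs : lam * volume.real (E ∩ Set.Icc p₀ θ) - (θ - p₀) = s)
    (ht : lam * volume.real (E ∩ Set.Icc θ q₀) - (q₀ - θ) = t) (hs0 : 0 ≤ s) (ht0 : 0 ≤ t)
    (hmax : ∀ x, θ ≤ x → lam * volume.real (E ∩ Set.Icc θ x) - (x - θ) ≤ t)
    (hz1 : z ≤ 1)
    (htail : ∀ x, θ + t / (lam - 1) ≤ x → (densityMeasure f).real (Set.Ioi (x + (s + t))) ≤
      z * (densityMeasure f).real (Set.Ioi x)) :
    ∃ β, 0 ≤ β ∧ (densityMeasure f).real (B ∩ Set.Ioi θ) ≤ z * β ∧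
      lam * (densityMeasure f).real (E ∩ Set.Ioi θ) ≤
        (lam - 1) * (densityMeasure f).real (Set.Ioc θ (θ + t / (lam - 1))) +
          ((densityMeasure f).real (Set.Ioi θ) - β) := by
  have hfin := hf.isFiniteMeasure
  have hlam0 : 0 < lam := by linarith
  have hlam1 : 0 < lam - 1 := by linarith
  set b := θ + t / (lam - 1) with hb
  have hbt : (lam - 1) * (b - θ) = t := by rw [hb]; field_simp; ring
  have hθb : θ ≤ b := by
    have : 0 ≤ t / (lam - 1) := by positivity
    linarith
  have hIoc : ∀ x, θ ≤ x →
      volume.real (Set.Ioc θ b ∩ Set.Ioc θ x) = min b x - θ := by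
    intro x hx
    rw [Set.Ioc_inter_Ioc, max_self, Real.volume_real_Ioc_of_le (le_min hθb hx)]
  have hcmp := fun S₂ hS₂ H => hf.mul_real_le_of_forall_Ioc hanti h.measurableSet
    (measurableSet_Ioc (a := θ) (b := b)) (S₂ := S₂) hS₂ hlam0.le hlam1.le zero_le_one H
  have hSb : Set.Ioc θ b ∩ Set.Ioi θ = Set.Ioc θ b :=
    Set.inter_eq_left.mpr Set.Ioc_subset_Ioi_self
  rw [hSb] at hcmp
  rcases (B ∩ Set.Ici θ).eq_empty_or_nonempty with hB | hB
  · refine ⟨0, le_rfl, ?_, ?_⟩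
    · have : B ∩ Set.Ioi θ = ∅ :=
        Set.subset_eq_empty (Set.inter_subset_inter_right _ Set.Ioi_subset_Ici_self) hB
      rw [this]; simp
    · have := hcmp Set.univ MeasurableSet.univ fun x hx => ?_
      · simpa using this
      · rw [hIoc x hx.le, Set.univ_inter, Real.volume_real_Ioc_of_le hx.le, volume_real_inter_Ioc]
        rcases le_total b x with hbx | hbx
        · rw [min_eq_left hbx, hbt]
          linarith [hmax x hx.le]
        · rw [min_eq_right hbx]
          nlinarith [volume_real_inter_Icc_le (E := E) hx.le]
  obtain ⟨q, hqB, hθq, hqmin⟩ : ∃ q ∈ B, θ ≤ q ∧ ∀ y ∈ B, θ ≤ y → q ≤ y := by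
    have hbd : BddBelow (B ∩ Set.Ici θ) := ⟨θ, fun y hy => hy.2⟩
    obtain ⟨h1, h2⟩ := (h.isClosed.inter isClosed_Ici).csInf_mem hB hbd
    exact ⟨_, h1, h2, fun y hy hy' => csInf_le hbd ⟨hy, hy'⟩⟩
  have hψq : lam * volume.real (E ∩ Set.Icc θ q) - (q - θ) ≤ -s := by
    have h1 := h.mul_le q hqB p₀
    rw [Set.uIcc_of_le (hp₀.trans hθq), abs_of_nonneg (by linarith),
      volume_real_inter_Icc_add h.measurableSet hp₀ hθq] at h1
    linarith
  have hq₀b : b ≤ q₀ := by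
    have h1 := volume_real_inter_Icc_le (E := E) hq₀
    nlinarith
  have hbq : b ≤ q - (s + t) := by
    rcases le_total q₀ q with hqq | hqq
    · rw [volume_real_inter_Icc_add h.measurableSet hq₀ hqq] at hψq
      have : 0 ≤ volume.real (E ∩ Set.Icc q₀ q) := measureReal_nonneg
      nlinarith
    · have h1 := h.mul_le q hqB q₀
      rw [Set.uIcc_of_ge hqq, abs_sub_comm, abs_of_nonneg (by linarith)] at h1
      rw [volume_real_inter_Icc_add h.measurableSet hθq hqq] at ht
      have hts : t ≤ -s := by linarith
      have hte : t = 0 := by linarith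
      have hse : s = 0 := by linarith
      rw [hte, zero_div, add_zero] at hb
      rw [hte, hse, hb]
      linarith
  have hcm : MeasurableSet (Set.Ici q \ B) := measurableSet_Ici.diff h.isClosed.measurableSet
  set o := (densityMeasure f).real (Set.Ici q \ B) with ho
  have ho0 : 0 ≤ o := measureReal_nonneg
  have hsub : Set.Ici q \ B ⊆ Set.Ioi (q - (s + t)) := by
    rintro y ⟨hy1, hy2⟩
    have hyq : q < y := lt_of_le_of_ne hy1 fun hh => hy2 (hh ▸ hqB)
    exact lt_of_le_of_lt (by linarith) hyq
  refine ⟨(densityMeasure f).real (Set.Ioi (q - (s + t))) - o,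
    sub_nonneg.mpr (measureReal_mono hsub), ?_, ?_⟩
  · have h1 : B ∩ Set.Ioi θ ⊆ Set.Ici q ∩ B := fun y hy => ⟨hqmin y hy.1 (le_of_lt hy.2), hy.1⟩
    have h2 := measureReal_inter_add_sdiff (μ := densityMeasure f) (s := Set.Ici q)
      h.isClosed.measurableSet
    have h3 := htail _ hbq
    rw [sub_add_cancel, ← densityMeasure_real_Ici] at h3
    have h4 : (densityMeasure f).real (B ∩ Set.Ioi θ) ≤ (densityMeasure f).real (Set.Ici q ∩ B) :=
      measureReal_mono h1
    nlinarith
  · have hS₂ : MeasurableSet (Set.Ioc θ (q - (s + t)) ∪ (Set.Ici q \ B)) :=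
      measurableSet_Ioc.union hcm
    have hdisj : Disjoint (Set.Ioc θ (q - (s + t))) (Set.Ici q \ B) := by
      rw [Set.disjoint_left]
      intro y hy1 hy2
      exact absurd hy1.2 (not_le.mpr (hsub hy2))
    have hνS₂ : (densityMeasure f).real
        ((Set.Ioc θ (q - (s + t)) ∪ (Set.Ici q \ B)) ∩ Set.Ioi θ) =
        (densityMeasure f).real (Set.Ioi θ) -
          ((densityMeasure f).real (Set.Ioi (q - (s + t))) - o) := by
      have hsubθ : Set.Ioc θ (q - (s + t)) ∪ (Set.Ici q \ B) ⊆ Set.Ioi θ := by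
        rintro y (hy | hy)
        · exact hy.1
        · exact lt_of_le_of_lt (hθb.trans hbq) (hsub hy)
      rw [Set.inter_eq_left.mpr hsubθ, measureReal_union hdisj hcm, ← Set.Ioi_sdiff_Ioi,
        measureReal_sdiff (Set.Ioi_subset_Ioi (hθb.trans hbq)) measurableSet_Ioi]
      ring
    have := hcmp _ hS₂ fun x hx => ?_
    · rw [hνS₂] at this
      linarith
    rw [hIoc x hx.le, volume_real_inter_Ioc]
    set S₂ := Set.Ioc θ (q - (s + t)) ∪ (Set.Ici q \ B) with hS₂def
    have hfin' : ∀ T : Set ℝ, volume (T ∩ Set.Ioc θ x) ≠ ⊤ := fun T =>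
      ((measure_mono Set.inter_subset_right).trans_lt measure_Ioc_lt_top).ne
    have hbase : min (q - (s + t)) x - θ ≤ volume.real (S₂ ∩ Set.Ioc θ x) := by
      rw [← Real.volume_real_Ioc_of_le (le_min (hθb.trans hbq) hx.le)]
      refine measureReal_mono ?_ (hfin' _)
      rintro y ⟨hy1, hy2⟩
      exact ⟨Or.inl ⟨hy1, hy2.trans (min_le_left _ _)⟩, hy1, hy2.trans (min_le_right _ _)⟩
    rcases le_total x b with hxb | hxb
    · rw [min_eq_right hxb]
      rw [min_eq_right (hxb.trans hbq)] at hbase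
      nlinarith [volume_real_inter_Icc_le (E := E) hx.le]
    rw [min_eq_left hxb, hbt]
    rcases le_total x (q - (s + t)) with hx1 | hx1
    · rw [min_eq_right hx1] at hbase
      linarith [hmax x hx.le]
    rw [min_eq_left hx1] at hbase
    rcases le_total x q with hx2 | hx2
    · have := volume_real_inter_Icc_mono (E := E) (x := θ) hx2
      nlinarith
    · have h1 := h.volume_Icc_le_diff hlam hqB hx2
      rw [volume_real_inter_Icc_add h.measurableSet hθq hx2]
      have h2 : (q - (s + t) - θ) + volume.real (Bᶜ ∩ Set.Icc q x) ≤
          volume.real (S₂ ∩ Set.Ioc θ x) := by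
        rw [← Real.volume_real_Ioc_of_le (hθb.trans hbq),
          ← measureReal_union ?_ ?_ measure_Ioc_lt_top.ne
          ((measure_mono Set.inter_subset_right).trans_lt measure_Icc_lt_top).ne]
        · refine measureReal_mono ?_ (hfin' _)
          rintro y (hy | ⟨hy1, hy2, hy3⟩)
          · exact ⟨Or.inl hy, hy.1, hy.2.trans hx1⟩
          · exact ⟨Or.inr ⟨hy2, hy1⟩, lt_of_le_of_lt (hθb.trans hbq) (hsub ⟨hy2, hy1⟩), hy3⟩
        · rw [Set.disjoint_left]
          rintro y hy1 ⟨hy2, hy3, -⟩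
          exact absurd hy1.2 (not_le.mpr (hsub ⟨hy3, hy2⟩))
        · exact h.isClosed.measurableSet.compl.inter measurableSet_Icc
      linarith

lemma exists_max_excess {lam : ℝ} {E B : Set ℝ} (h : RemezPosition lam E B) (hlam : 1 < lam)
    (θ : ℝ) : ∃ q, θ ≤ q ∧ 0 ≤ lam * volume.real (E ∩ Set.Icc θ q) - (q - θ) ∧
      ∀ x, θ ≤ x → lam * volume.real (E ∩ Set.Icc θ x) - (x - θ) ≤
        lam * volume.real (E ∩ Set.Icc θ q) - (q - θ) := by
  obtain ⟨R, hR⟩ := h.bounded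
  have hcont : Continuous fun x => lam * volume.real (E ∩ Set.Icc θ x) - (x - θ) :=
    ((continuous_volume_real_inter_Icc θ).const_mul lam).sub (continuous_id.sub continuous_const)
  have hθ : θ ≤ max θ R := le_max_left _ _
  obtain ⟨q, hq, hmax⟩ := isCompact_Icc.exists_isMaxOn (Set.nonempty_Icc.mpr hθ) hcont.continuousOn
  have hmax' : ∀ x ∈ Set.Icc θ (max θ R), lam * volume.real (E ∩ Set.Icc θ x) - (x - θ) ≤
      lam * volume.real (E ∩ Set.Icc θ q) - (q - θ) := fun x hx => hmax hx
  refine ⟨q, hq.1, ?_, fun x hx => ?_⟩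
  · refine le_trans ?_ (hmax' θ ⟨le_rfl, hθ⟩)
    rw [sub_self, sub_zero]
    have : 0 ≤ volume.real (E ∩ Set.Icc θ θ) := measureReal_nonneg
    have : 0 < lam := by linarith
    positivity
  · rcases le_total x (max θ R) with hx' | hx'
    · exact hmax' x ⟨hx, hx'⟩
    · refine le_trans ?_ (hmax' _ ⟨hθ, le_rfl⟩)
      have : E ∩ Set.Icc θ x ⊆ E ∩ Set.Icc θ (max θ R) := fun y hy =>
        ⟨hy.1, hy.2.1, ((le_abs_self y).trans (hR y hy.1)).trans (le_max_right _ _)⟩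
      have h2 : volume.real (E ∩ Set.Icc θ x) ≤ volume.real (E ∩ Set.Icc θ (max θ R)) :=
        measureReal_mono this ((measure_mono Set.inter_subset_right).trans_lt measure_Icc_lt_top).ne
      nlinarith

lemma volume_real_preimage_neg (S : Set ℝ) : volume.real (Neg.neg ⁻¹' S) = volume.real S := by
  rw [measureReal_def, Set.neg_preimage, Measure.measure_neg, ← measureReal_def]

lemma preimage_neg_inter_Icc {E : Set ℝ} (x y : ℝ) :
    Neg.neg ⁻¹' E ∩ Set.Icc x y = Neg.neg ⁻¹' (E ∩ Set.Icc (-y) (-x)) := by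
  rw [Set.preimage_inter, Set.neg_preimage (s := Set.Icc _ _), Set.neg_Icc]
  simp

/-- Dilation-type inequality for log-concave probability measures on the line. -/
theorem densityMeasure_le_rpow {f : ℝ → ℝ} (hf : IsLogConcaveProfile f)
    (hprob : densityMeasure f Set.univ = 1) {lam : ℝ} {E B : Set ℝ}
    (h : RemezPosition lam E B) (hlam : 1 < lam) :
    (densityMeasure f).real B ≤ (1 - (densityMeasure f).real E) ^ lam := by
  have hfin := hf.isFiniteMeasure
  have hlam0 : 0 < lam := by linarith
  have hlam1 : 0 < lam - 1 := by linarith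
  have hf' := hf.comp_neg
  have hν' : ∀ S, (densityMeasure fun x => f (-x)).real S =
      (densityMeasure f).real (Neg.neg ⁻¹' S) := fun S => by
    rw [measureReal_def, measureReal_def, densityMeasure_neg]
  have hpos : ∃ x, 0 < f x := by
    by_contra! hle
    have : densityMeasure f Set.univ = 0 := by
      rw [densityMeasure, withDensity_apply _ MeasurableSet.univ]
      simp [ENNReal.ofReal_of_nonpos (hle _)]
    rw [this] at hprob
    exact zero_ne_one hprob
  obtain ⟨θ, hmono, hanti⟩ := hf.exists_mode hpos
  have h' := h.preimage_neg
  obtain ⟨q₀, hq₀, ht0, htmax⟩ := h.exists_max_excess hlam θ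
  obtain ⟨p', hp', hs0, hsmax⟩ := h'.exists_max_excess hlam (-θ)
  set t := lam * volume.real (E ∩ Set.Icc θ q₀) - (q₀ - θ) with ht
  set s := lam * volume.real (Neg.neg ⁻¹' E ∩ Set.Icc (-θ) p') - (p' - -θ) with hs
  have hs' : lam * volume.real (E ∩ Set.Icc (-p') θ) - (θ - -p') = s := by
    rw [hs, preimage_neg_inter_Icc, volume_real_preimage_neg, neg_neg]
    ring
  have ht' : lam * volume.real (Neg.neg ⁻¹' E ∩ Set.Icc (-q₀) (-θ)) - (-θ - -q₀) = t := by
    rw [ht, preimage_neg_inter_Icc, volume_real_preimage_neg, neg_neg, neg_neg]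
    ring
  set a := θ - s / (lam - 1) with ha
  set b := θ + t / (lam - 1) with hb
  have hsd : 0 ≤ s / (lam - 1) := by positivity
  have htd : 0 ≤ t / (lam - 1) := by positivity
  have hab : a ≤ b := by linarith
  have hS : (lam - 1) * (b - a) = s + t := by rw [ha, hb]; field_simp; ring
  set N := 1 - (densityMeasure f).real (Set.Icc a b) with hN
  have hr1 : ∀ S, (densityMeasure f).real S ≤ 1 := fun S => by
    refine (measureReal_mono (Set.subset_univ _)).trans ?_
    rw [measureReal_def, hprob]; simp
  have hN0 : 0 ≤ N := sub_nonneg.mpr (hr1 _)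
  have hN1 : N ≤ 1 := sub_le_self _ measureReal_nonneg
  have hz0 : 0 ≤ N ^ (lam - 1) := Real.rpow_nonneg hN0 _
  have hz1 : N ^ (lam - 1) ≤ 1 := Real.rpow_le_one hN0 hN1 hlam1.le
  obtain ⟨β, hβ0, hβB, hβE⟩ := h.exists_right_balance hf hlam hanti (by linarith) hq₀ hs' rfl hs0
    ht0 htmax hz1 fun x hx => by
      have := hf.tail_shift_le hprob hlam hab hx
      rwa [hS] at this
  have hprob' : densityMeasure (fun x => f (-x)) Set.univ = 1 := by
    rw [densityMeasure_neg, Set.preimage_univ, hprob]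
  have hanti' : AntitoneOn (fun x => f (-x)) (Set.Ioi (-θ)) := by
    intro x hx y hy hxy
    rw [Set.mem_Ioi] at hx hy
    exact hmono (by rw [Set.mem_Iio]; linarith) (by rw [Set.mem_Iio]; linarith) (by linarith)
  have hnegIcc : (densityMeasure fun x => f (-x)).real (Set.Icc (-b) (-a)) =
      (densityMeasure f).real (Set.Icc a b) := by
    rw [hν', Set.neg_preimage, Set.neg_Icc, neg_neg, neg_neg]
  obtain ⟨γ, hγ0, hγB, hγE⟩ := h'.exists_right_balance hf' hlam hanti' (neg_le_neg hq₀) hp' ht' rfl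
    ht0 hs0 hsmax hz1 fun x hx => by
      have := hf'.tail_shift_le hprob' hlam (neg_le_neg hab) (x := x) (by rw [ha]; linarith)
      rw [hnegIcc] at this
      have e : (lam - 1) * (-a - -b) = t + s := by linarith
      rwa [e] at this
  have hnegIoi : ∀ T : Set ℝ, Neg.neg ⁻¹' (Neg.neg ⁻¹' T ∩ Set.Ioi (-θ)) = T ∩ Set.Iio θ := by
    intro T
    ext x
    simp
  have hnegIoi' : Neg.neg ⁻¹' Set.Ioi (-θ) = Set.Iio θ := by ext x; simp
  have hnegIoc : Neg.neg ⁻¹' Set.Ioc (-θ) (-θ + s / (lam - 1)) = Set.Ico a θ := by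
    ext x
    simp only [Set.mem_preimage, Set.mem_Ioc, Set.mem_Ico, ha]
    constructor <;> rintro ⟨h1, h2⟩ <;> constructor <;> linarith
  rw [hν', hnegIoi] at hγB
  rw [hν', hν', hν', hnegIoi, hnegIoi', hnegIoc] at hγE
  have hsplit : ∀ T : Set ℝ, MeasurableSet T → (densityMeasure f).real T =
      (densityMeasure f).real (T ∩ Set.Iio θ) + (densityMeasure f).real (T ∩ Set.Ioi θ) := by
    intro T hT
    rw [← measureReal_union]
    · rw [← Set.inter_union_distrib_left, Set.Iio_union_Ioi, ← Set.sdiff_eq, measureReal_def,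
        measureReal_def, measure_sdiff_null (densityMeasure_singleton f θ)]
    · rw [Set.disjoint_left]
      rintro x ⟨-, h1⟩ ⟨-, h2⟩
      exact lt_asymm (Set.mem_Iio.mp h1) (Set.mem_Ioi.mp h2)
    · exact hT.inter measurableSet_Ioi
  have hE := hsplit E h.measurableSet
  have hB := hsplit B h.isClosed.measurableSet
  have hU := hsplit Set.univ MeasurableSet.univ
  rw [Set.univ_inter, Set.univ_inter, measureReal_def, hprob, ENNReal.toReal_one] at hU
  have hIcc : (densityMeasure f).real (Set.Icc a b) =
      (densityMeasure f).real (Set.Ico a θ) + (densityMeasure f).real (Set.Ioc θ b) := by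
    rw [hsplit _ measurableSet_Icc]
    congr 2
    · ext x
      simp only [Set.mem_inter_iff, Set.mem_Icc, Set.mem_Iio, Set.mem_Ico]
      constructor
      · rintro ⟨⟨h1, h2⟩, h3⟩; exact ⟨h1, h3⟩
      · rintro ⟨h1, h2⟩; exact ⟨⟨h1, by linarith⟩, h2⟩
    · ext x
      simp only [Set.mem_inter_iff, Set.mem_Icc, Set.mem_Ioi, Set.mem_Ioc]
      constructor
      · rintro ⟨⟨h1, h2⟩, h3⟩; exact ⟨h3, h2⟩
      · rintro ⟨h1, h2⟩; exact ⟨⟨by linarith, h2⟩, h1⟩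
  have hβγ : 0 ≤ β + γ := add_nonneg hβ0 hγ0
  have key : (lam - 1) * N + (β + γ) ≤ lam * (1 - (densityMeasure f).real E) := by
    rw [hN, hIcc, hE]
    linarith
  have hBle : (densityMeasure f).real B ≤ N ^ (lam - 1) * (β + γ) := by
    rw [hB]; linarith
  have amgm := Real.geom_mean_le_arith_mean2_weighted (w₁ := (lam - 1) / lam) (w₂ := 1 / lam)
    (by positivity) (by positivity) hN0 hβγ (by field_simp; ring)
  have hle : N ^ ((lam - 1) / lam) * (β + γ) ^ (1 / lam) ≤ 1 - (densityMeasure f).real E := by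
    refine amgm.trans ?_
    rw [← sub_nonneg] at key ⊢
    have : 1 - (densityMeasure f).real E - ((lam - 1) / lam * N + 1 / lam * (β + γ)) =
        (lam * (1 - (densityMeasure f).real E) - ((lam - 1) * N + (β + γ))) / lam := by
      field_simp
    rw [this]
    positivity
  refine hBle.trans ?_
  have hpow := Real.rpow_le_rpow (mul_nonneg (Real.rpow_nonneg hN0 _) (Real.rpow_nonneg hβγ _))
    hle hlam0.le
  rw [Real.mul_rpow (Real.rpow_nonneg hN0 _) (Real.rpow_nonneg hβγ _), ← Real.rpow_mul hN0,
    ← Real.rpow_mul hβγ, div_mul_cancel₀ _ hlam0.ne', div_mul_cancel₀ _ hlam0.ne',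
    Real.rpow_one] at hpow
  exact hpow

end RemezPosition

lemma remezPosition_eval {p : Polynomial ℝ} {d : ℕ} (hp : p.natDegree ≤ d) (hd : 0 < d)
    {M lam : ℝ} (hM : 0 < M) (hlam : 1 < lam) (R : ℝ) :
    RemezPosition lam ({x | |p.eval x| < M} ∩ Set.Icc (-R) R)
      {x | (4 * lam) ^ d * M ≤ |p.eval x|} where
  measurableSet := (measurableSet_lt p.continuous.abs.measurable measurable_const).inter
    measurableSet_Icc
  isClosed := isClosed_le continuous_const p.continuous.abs
  bounded := ⟨R, fun x hx => abs_le.mpr hx.2⟩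
  mul_le y hy x := by
    refine le_trans ?_ (remez hp hd hM hlam.le hy x)
    refine mul_le_mul_of_nonneg_left (measureReal_mono
      (Set.inter_subset_inter_left _ Set.inter_subset_left) ?_) (by linarith)
    exact ((measure_mono Set.inter_subset_right).trans_lt isCompact_uIcc.measure_lt_top).ne
  compl_mem_nhds y hy := by
    have h1 : 1 < (4 * lam) ^ d := one_lt_pow₀ (by linarith) hd.ne'
    have h2 : M < |p.eval y| := lt_of_lt_of_le (by nlinarith) hy
    filter_upwards [p.continuous.abs.continuousAt.eventually (lt_mem_nhds h2)] with z hz hzE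
    exact lt_asymm hz hzE.1

/-- The distribution inequality for polynomials of one variable and log-concave densities. -/
theorem IsLogConcaveProfile.setIntegral_le_rpow {f : ℝ → ℝ} (hf : IsLogConcaveProfile f)
    (hm : 0 < ∫ x, f x) {p : Polynomial ℝ} {d : ℕ} (hp : p.natDegree ≤ d) (hd : 0 < d)
    {M lam : ℝ} (hM : 0 < M) (hlam : 1 < lam) :
    ∫ x in {x | (4 * lam) ^ d * M ≤ |p.eval x|}, f x ≤
      (∫ x, f x) * ((∫ x in {x | M ≤ |p.eval x|}, f x) / ∫ x, f x) ^ lam := by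
  set m := ∫ x, f x with hmdef
  have hg := hf.const_mul (inv_pos.mpr hm)
  have hν : ∀ {S : Set ℝ}, MeasurableSet S →
      (densityMeasure fun x => m⁻¹ * f x).real S = m⁻¹ * ∫ x in S, f x := fun hS => by
    rw [hg.real_densityMeasure hS, integral_const_mul]
  have hfin := hg.isFiniteMeasure
  have hprob' : (densityMeasure fun x => m⁻¹ * f x).real Set.univ = 1 := by
    rw [hν MeasurableSet.univ, setIntegral_univ, inv_mul_cancel₀ hm.ne']
  have hprob : densityMeasure (fun x => m⁻¹ * f x) Set.univ = 1 := by
    rwa [measureReal_def, ENNReal.toReal_eq_one_iff] at hprob'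
  obtain ⟨R, hR⟩ := hf.support
  have hR' : ∀ x, x ∉ Set.Icc (-R) R → f x = 0 := fun x hx => hR x (by
    by_contra! hle
    exact hx (abs_le.mp hle))
  have hmeasE : MeasurableSet {x | |p.eval x| < M} :=
    measurableSet_lt p.continuous.abs.measurable measurable_const
  have key := (remezPosition_eval hp hd hM hlam R).densityMeasure_le_rpow hg hprob hlam
  have hE : ∫ x in {x | |p.eval x| < M} ∩ Set.Icc (-R) R, f x =
      ∫ x in {x | |p.eval x| < M}, f x := by
    rw [← setIntegral_indicator measurableSet_Icc]
    congr 1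
    ext x
    by_cases hx : x ∈ Set.Icc (-R) R
    · rw [Set.indicator_of_mem hx]
    · rw [Set.indicator_of_notMem hx, hR' x hx]
  have hcompl : {x | M ≤ |p.eval x|} = {x | |p.eval x| < M}ᶜ := by
    ext x; simp
  have hadd := integral_add_compl hmeasE hf.integrable
  rw [← hcompl, ← hmdef] at hadd
  rw [hν (hmeasE.inter measurableSet_Icc), hE,
    hν (isClosed_le continuous_const p.continuous.abs).measurableSet] at key
  have e : 1 - m⁻¹ * ∫ x in {x | |p.eval x| < M}, f x = (∫ x in {x | M ≤ |p.eval x|}, f x) / m := by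
    rw [eq_div_iff hm.ne', sub_mul, mul_right_comm, inv_mul_cancel₀ hm.ne']
    linarith
  rwa [e, inv_mul_le_iff₀ hm] at key

section RotatingHalfSpace

variable {n : ℕ}

/-- The half-space of points `x` whose projection to the `(i, j)` coordinate plane lies on the
side of direction `θ` of a line through `(a, b)`. -/
def rotatingHalfSpace (i j : Fin n) (a b θ : ℝ) : Set (Fin n → ℝ) :=
  {x | 0 ≤ Real.cos θ * (x i - a) + Real.sin θ * (x j - b)}

lemma isClosed_rotatingHalfSpace (i j : Fin n) (a b θ : ℝ) :
    IsClosed (rotatingHalfSpace i j a b θ) :=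
  isClosed_le continuous_const (by fun_prop)

lemma convex_rotatingHalfSpace (i j : Fin n) (a b θ : ℝ) :
    Convex ℝ (rotatingHalfSpace i j a b θ) := by
  intro x hx y hy s t hs ht hst
  simp only [rotatingHalfSpace, Set.mem_ofPred_eq, Pi.add_apply, Pi.smul_apply, smul_eq_mul] at *
  have e : Real.cos θ * (s * x i + t * y i - a) + Real.sin θ * (s * x j + t * y j - b) =
      s * (Real.cos θ * (x i - a) + Real.sin θ * (x j - b)) +
        t * (Real.cos θ * (y i - a) + Real.sin θ * (y j - b)) := by
    have ht' : t = 1 - s := by linarith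
    rw [ht']; ring
  rw [e]
  positivity

lemma volume_boundary_rotatingHalfSpace {i j : Fin n} (hij : i ≠ j) (a b θ : ℝ) :
    volume {x : Fin n → ℝ | Real.cos θ * (x i - a) + Real.sin θ * (x j - b) = 0} = 0 := by
  set f : (Fin n → ℝ) →ₗ[ℝ] ℝ :=
    Real.cos θ • LinearMap.proj i + Real.sin θ • LinearMap.proj j with hf
  set H : AffineSubspace ℝ (Fin n → ℝ) :=
    (AffineSubspace.mk' (Real.cos θ * a + Real.sin θ * b) ⊥).comap f.toAffineMap with hH
  have hmem : ∀ x, x ∈ H ↔ Real.cos θ * (x i - a) + Real.sin θ * (x j - b) = 0 := by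
    intro x
    simp only [hH, hf, AffineSubspace.mem_comap, AffineSubspace.mem_mk', Submodule.mem_bot,
      vsub_eq_sub, LinearMap.coe_toAffineMap, LinearMap.add_apply, LinearMap.smul_apply,
      LinearMap.proj_apply, smul_eq_mul]
    constructor <;> intro h <;> linarith
  have hne : H ≠ ⊤ := by
    intro htop
    have h1 := (hmem (fun k => if k = i then a + Real.cos θ else b + Real.sin θ)).mp
      (htop ▸ AffineSubspace.mem_top ℝ _ _)
    simp only [if_true, if_neg hij.symm] at h1
    nlinarith [Real.cos_sq_add_sin_sq θ]
  have h := Measure.addHaar_affineSubspace volume H hne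
  refine (congrArg volume ?_).trans h
  ext x
  exact (hmem x).symm

lemma continuous_volume_inter_rotatingHalfSpace {i j : Fin n} (hij : i ≠ j) (a b : ℝ)
    {T : Set (Fin n → ℝ)} (hT : MeasurableSet T) (hfin : volume T ≠ ⊤) :
    Continuous fun θ => volume.real (T ∩ rotatingHalfSpace i j a b θ) := by
  have hm : ∀ θ, MeasurableSet (T ∩ rotatingHalfSpace i j a b θ) := fun θ =>
    hT.inter (isClosed_rotatingHalfSpace i j a b θ).measurableSet
  have e : (fun θ => volume.real (T ∩ rotatingHalfSpace i j a b θ)) =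
      fun θ => ∫ x, (T ∩ rotatingHalfSpace i j a b θ).indicator (fun _ => (1 : ℝ)) x := by
    funext θ
    rw [integral_indicator_const _ (hm θ), smul_eq_mul, mul_one]
  rw [e, continuous_iff_continuousAt]
  intro θ
  refine continuousAt_of_dominated (bound := T.indicator fun _ => (1 : ℝ)) ?_ ?_ ?_ ?_
  · exact Filter.Eventually.of_forall fun θ' =>
      ((measurable_const.indicator (hm θ')).aestronglyMeasurable)
  · refine Filter.Eventually.of_forall fun θ' => Filter.Eventually.of_forall fun x => ?_
    rw [norm_indicator_eq_indicator_norm]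
    simp only [norm_one]
    exact Set.indicator_le_indicator_of_subset Set.inter_subset_left (fun _ => zero_le_one) x
  · exact (integrable_indicator_iff hT).mpr (integrableOn_const hfin)
  · have h0 := volume_boundary_rotatingHalfSpace hij a b θ
    have hae : ∀ᵐ x : Fin n → ℝ, ¬ Real.cos θ * (x i - a) + Real.sin θ * (x j - b) = 0 :=
      measure_eq_zero_iff_ae_notMem.mp h0
    filter_upwards [hae] with x hx
    have hcont : Continuous fun θ' => Real.cos θ' * (x i - a) + Real.sin θ' * (x j - b) := by
      fun_prop
    have hev : ∀ᶠ θ' in nhds θ,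
        (x ∈ rotatingHalfSpace i j a b θ' ↔ x ∈ rotatingHalfSpace i j a b θ) := by
      rcases lt_or_gt_of_ne hx with hx | hx
      · filter_upwards [hcont.continuousAt.eventually (gt_mem_nhds hx)] with θ' h'
        exact iff_of_false (not_le.mpr h') (not_le.mpr hx)
      · filter_upwards [hcont.continuousAt.eventually (lt_mem_nhds hx)] with θ' h'
        exact iff_of_true h'.le hx.le
    refine (continuousAt_const (y := (T ∩ rotatingHalfSpace i j a b θ).indicator
      (fun _ => (1 : ℝ)) x)).congr ?_
    filter_upwards [hev] with θ' h'
    classical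
    rw [Set.indicator_apply, Set.indicator_apply]
    exact if_congr (and_congr_right fun _ => h'.symm) rfl rfl

lemma volume_inter_rotatingHalfSpace_add {i j : Fin n} (hij : i ≠ j) (a b θ : ℝ)
    {T : Set (Fin n → ℝ)} (hfin : volume T ≠ ⊤) :
    volume.real (T ∩ rotatingHalfSpace i j a b θ) +
      volume.real (T ∩ rotatingHalfSpace i j a b (θ + Real.pi)) = volume.real T := by
  have hmem : ∀ x, x ∈ rotatingHalfSpace i j a b (θ + Real.pi) ↔
      Real.cos θ * (x i - a) + Real.sin θ * (x j - b) ≤ 0 := by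
    intro x
    rw [rotatingHalfSpace, Set.mem_ofPred_eq, Real.cos_add_pi, Real.sin_add_pi]
    constructor <;> intro h <;> linarith
  rw [← measureReal_inter_add_sdiff (s := T)
    (isClosed_rotatingHalfSpace i j a b θ).measurableSet hfin]
  congr 1
  refine measureReal_congr ?_
  have hae : ∀ᵐ x : Fin n → ℝ, ¬ Real.cos θ * (x i - a) + Real.sin θ * (x j - b) = 0 :=
    measure_eq_zero_iff_ae_notMem.mp (volume_boundary_rotatingHalfSpace hij a b θ)
  filter_upwards [hae] with x hx
  refine propext (and_congr_right fun _ => ?_)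
  refine (hmem x).trans ?_
  rw [rotatingHalfSpace, Set.mem_ofPred_eq, not_le]
  exact ⟨fun h => lt_of_le_of_ne h hx, le_of_lt⟩

/-- Convex bodies on which `A` has relative volume `α` and `B` has relative volume above `β`. -/
structure IsBalancedBody (A B : Set (Fin n → ℝ)) (α β : ℝ) (K : Set (Fin n → ℝ)) : Prop where
  isCompact : IsCompact K
  convex : Convex ℝ K
  volume_inter_eq : volume.real (A ∩ K) = α * volume.real K
  lt_volume_inter : β * volume.real K < volume.real (B ∩ K)

namespace IsBalancedBody

variable {A B K : Set (Fin n → ℝ)} {α β : ℝ}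

lemma volume_pos (hK : IsBalancedBody A B α β K) : 0 < volume.real K := by
  refine lt_of_le_of_ne measureReal_nonneg fun h0 => ?_
  have h1 : volume.real (B ∩ K) ≤ volume.real K :=
    measureReal_mono Set.inter_subset_right hK.isCompact.measure_lt_top.ne
  have h2 := hK.lt_volume_inter
  rw [← h0, mul_zero] at h2
  linarith

lemma exists_cut (hK : IsBalancedBody A B α β K) (hA : MeasurableSet A) {i j : Fin n} (hij : i ≠ j)
    (a b : ℝ) : ∃ θ, IsBalancedBody A B α β (K ∩ rotatingHalfSpace i j a b θ) := by
  have hKfin : volume K ≠ ⊤ := hK.isCompact.measure_lt_top.ne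
  have hfin : ∀ T, volume (T ∩ K) ≠ ⊤ := fun T =>
    ((measure_mono Set.inter_subset_right).trans_lt hK.isCompact.measure_lt_top).ne
  have hKm := hK.isCompact.measurableSet
  set g : ℝ → ℝ := fun θ => volume.real (A ∩ K ∩ rotatingHalfSpace i j a b θ) -
    α * volume.real (K ∩ rotatingHalfSpace i j a b θ) with hg
  have hcont : Continuous g :=
    (continuous_volume_inter_rotatingHalfSpace hij a b (hA.inter hKm) (hfin A)).sub
      ((continuous_volume_inter_rotatingHalfSpace hij a b hKm hKfin).const_mul α)
  have hsum : ∀ θ, g θ + g (θ + Real.pi) = 0 := by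
    intro θ
    have h1 := volume_inter_rotatingHalfSpace_add hij a b θ (hfin A)
    have h2 := volume_inter_rotatingHalfSpace_add hij a b θ hKfin
    have h3 := hK.volume_inter_eq
    simp only [hg]
    rw [← h1, ← h2] at h3
    linarith
  obtain ⟨θ, -, hθ⟩ : ∃ θ ∈ Set.uIcc 0 (0 + Real.pi), g θ = 0 := by
    refine intermediate_value_uIcc hcont.continuousOn ?_
    have := hsum 0
    rw [Set.mem_uIcc]
    rcases le_total (g 0) 0 with h | h
    · exact Or.inl ⟨h, by linarith⟩
    · exact Or.inr ⟨by linarith, h⟩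
  have hθ' : g (θ + Real.pi) = 0 := by have := hsum θ; linarith
  have hbal : ∀ φ, g φ = 0 → β * volume.real (K ∩ rotatingHalfSpace i j a b φ) <
      volume.real (B ∩ K ∩ rotatingHalfSpace i j a b φ) →
      IsBalancedBody A B α β (K ∩ rotatingHalfSpace i j a b φ) := fun φ h1 h2 =>
    ⟨hK.isCompact.inter_right (isClosed_rotatingHalfSpace i j a b φ),
      hK.convex.inter (convex_rotatingHalfSpace i j a b φ),
      by rw [← Set.inter_assoc]; exact sub_eq_zero.mp h1, by rwa [← Set.inter_assoc]⟩
  by_contra! hno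
  have h1 := not_lt.mp fun h => hno θ (hbal θ hθ h)
  have h2 := not_lt.mp fun h => hno (θ + Real.pi) (hbal _ hθ' h)
  have h3 := volume_inter_rotatingHalfSpace_add hij a b θ (hfin B)
  have h4 := volume_inter_rotatingHalfSpace_add hij a b θ hKfin
  have h5 := hK.lt_volume_inter
  rw [← h3, ← h4] at h5
  linarith

end IsBalancedBody

end RotatingHalfSpace

lemma cross_eq_zero_of_forall_rat_halfPlane {x y z : ℝ × ℝ}
    (h : ∀ a b : ℚ, ∃ u v : ℝ, u ^ 2 + v ^ 2 = 1 ∧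
      ∀ w ∈ ({x, y, z} : Set (ℝ × ℝ)), 0 ≤ u * (w.1 - a) + v * (w.2 - b)) :
    (y.1 - x.1) * (z.2 - x.2) - (y.2 - x.2) * (z.1 - x.1) = 0 := by
  by_contra hD
  set D := (y.1 - x.1) * (z.2 - x.2) - (y.2 - x.2) * (z.1 - x.1) with hDdef
  set s : ℝ × ℝ → ℝ := fun p => ((p.1 - x.1) * (z.2 - x.2) - (p.2 - x.2) * (z.1 - x.1)) / D with hs
  set t : ℝ × ℝ → ℝ := fun p => ((y.1 - x.1) * (p.2 - x.2) - (y.2 - x.2) * (p.1 - x.1)) / D with ht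
  have hsc : Continuous s := by rw [hs]; fun_prop
  have htc : Continuous t := by rw [ht]; fun_prop
  have hopen : IsOpen {p | 0 < s p ∧ 0 < t p ∧ s p + t p < 1} :=
    (isOpen_lt continuous_const hsc).inter
      ((isOpen_lt continuous_const htc).inter (isOpen_lt (hsc.add htc) continuous_const))
  have hne : {p | 0 < s p ∧ 0 < t p ∧ s p + t p < 1}.Nonempty := by
    have h1 : s ((x.1 + y.1 + z.1) / 3, (x.2 + y.2 + z.2) / 3) = 1 / 3 := by
      simp only [hs]; rw [div_eq_iff hD, hDdef]; ring
    have h2 : t ((x.1 + y.1 + z.1) / 3, (x.2 + y.2 + z.2) / 3) = 1 / 3 := by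
      simp only [ht]; rw [div_eq_iff hD, hDdef]; ring
    refine ⟨((x.1 + y.1 + z.1) / 3, (x.2 + y.2 + z.2) / 3), ?_⟩
    rw [Set.mem_ofPred_eq, h1, h2]
    norm_num
  obtain ⟨⟨a, b⟩, hab⟩ :=
    (Rat.denseRange_cast.prodMap Rat.denseRange_cast).exists_mem_open hopen hne
  obtain ⟨u, v, huv, hw⟩ := h a b
  obtain ⟨h1, h2, h3⟩ := hab
  rw [Prod.map_apply] at h1 h2 h3
  set α := s ((a : ℝ), (b : ℝ)) with hα
  set β := t ((a : ℝ), (b : ℝ)) with hβ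
  have hx := hw x (by simp)
  have hy := hw y (by simp)
  have hz := hw z (by simp)
  have hα' : α * D = (a - x.1) * (z.2 - x.2) - (b - x.2) * (z.1 - x.1) := div_mul_cancel₀ _ hD
  have hβ' : β * D = (y.1 - x.1) * (b - x.2) - (y.2 - x.2) * (a - x.1) := div_mul_cancel₀ _ hD
  have e1 : α * (y.1 - x.1) + β * (z.1 - x.1) = a - x.1 := by
    refine mul_right_cancel₀ hD ?_
    linear_combination (y.1 - x.1) * hα' + (z.1 - x.1) * hβ' - (a - x.1) * hDdef
  have e2 : α * (y.2 - x.2) + β * (z.2 - x.2) = b - x.2 := by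
    refine mul_right_cancel₀ hD ?_
    linear_combination (y.2 - x.2) * hα' + (z.2 - x.2) * hβ' - (b - x.2) * hDdef
  set X := u * (x.1 - a) + v * (x.2 - b) with hX
  set Y := u * (y.1 - a) + v * (y.2 - b) with hY
  set Z := u * (z.1 - a) + v * (z.2 - b) with hZ
  have hcomb : (1 - α - β) * X + α * Y + β * Z = 0 := by
    rw [hX, hY, hZ]
    linear_combination u * e1 + v * e2
  have k1 : 0 ≤ (1 - α - β) * X := mul_nonneg (by linarith) hx
  have k2 : 0 ≤ α * Y := mul_nonneg h1.le hy
  have k3 : 0 ≤ β * Z := mul_nonneg h2.le hz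
  have hX0 : X = 0 := by
    have : (1 - α - β) * X = 0 := by linarith
    exact (mul_eq_zero.mp this).resolve_left (by linarith)
  have hY0 : Y = 0 := (mul_eq_zero.mp (by linarith : α * Y = 0)).resolve_left h1.ne'
  have hZ0 : Z = 0 := (mul_eq_zero.mp (by linarith : β * Z = 0)).resolve_left h2.ne'
  have hu : u * D = 0 := by
    rw [hDdef]
    linear_combination (z.2 - x.2) * (hY0 - hX0) - (y.2 - x.2) * (hZ0 - hX0)
  have hv : v * D = 0 := by
    rw [hDdef]
    linear_combination (y.1 - x.1) * (hZ0 - hX0) - (z.1 - x.1) * (hY0 - hX0)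
  rw [(mul_eq_zero.mp hu).resolve_right hD, (mul_eq_zero.mp hv).resolve_right hD] at huv
  norm_num at huv

section Needle

variable {n : ℕ}

lemma exists_line_of_cross_eq_zero (i₀ : Fin n) {S : Set (Fin n → ℝ)} (hne : S.Nonempty)
    (h : ∀ x ∈ S, ∀ y ∈ S, ∀ z ∈ S, ∀ i j, i ≠ j →
      (y i - x i) * (z j - x j) - (y j - x j) * (z i - x i) = 0) :
    ∃ (i : Fin n) (x v : Fin n → ℝ), v i = 1 ∧ ∀ z ∈ S, z = x + (z i - x i) • v := by
  obtain ⟨x, hx⟩ := hne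
  by_cases hall : ∀ y ∈ S, y = x
  · refine ⟨i₀, x, Pi.single i₀ 1, by simp, fun z hz => ?_⟩
    rw [hall z hz]; simp
  · push Not at hall
    obtain ⟨y, hy, hyx⟩ := hall
    obtain ⟨i, hi⟩ := Function.ne_iff.mp hyx
    have hi' : y i - x i ≠ 0 := sub_ne_zero.mpr hi
    refine ⟨i, x, (y i - x i)⁻¹ • (y - x), by simp [hi'], fun z hz => ?_⟩
    funext j
    simp only [Pi.add_apply, Pi.smul_apply, Pi.sub_apply, smul_eq_mul]
    by_cases hj : i = j
    · subst hj
      field_simp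
      ring
    · have := h x hx y hy z hz i j hj
      field_simp
      linarith

namespace IsBalancedBody

variable {A B F : Set (Fin n → ℝ)} {α β : ℝ}

lemma exists_antitone_seq (hF : IsBalancedBody A B α β F) (hA : MeasurableSet A)
    (i₀ : Fin n) : ∃ K : ℕ → Set (Fin n → ℝ), Antitone K ∧ (∀ m, IsBalancedBody A B α β (K m)) ∧
      ∀ i j : Fin n, i ≠ j → ∀ a b : ℚ, ∃ m θ, K m ⊆ rotatingHalfSpace i j a b θ := by
  have hcut : ∀ (K : {K // IsBalancedBody A B α β K}) (c : (Fin n × Fin n) × ℚ × ℚ),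
      ∃ K' : {K // IsBalancedBody A B α β K}, K'.1 ⊆ K.1 ∧
        (c.1.1 ≠ c.1.2 → ∃ θ, K'.1 ⊆ rotatingHalfSpace c.1.1 c.1.2 c.2.1 c.2.2 θ) := by
    intro K c
    by_cases hc : c.1.1 = c.1.2
    · exact ⟨K, subset_rfl, fun h => absurd hc h⟩
    · obtain ⟨θ, hθ⟩ := K.2.exists_cut hA hc c.2.1 c.2.2
      exact ⟨⟨_, hθ⟩, Set.inter_subset_left, fun _ => ⟨θ, Set.inter_subset_right⟩⟩
  choose next hnext hnext' using hcut
  have : Nonempty ((Fin n × Fin n) × ℚ × ℚ) := ⟨(i₀, i₀), 0, 0⟩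
  obtain ⟨c, hc⟩ := exists_surjective_nat ((Fin n × Fin n) × ℚ × ℚ)
  let K : ℕ → {K // IsBalancedBody A B α β K} := fun m =>
    Nat.rec ⟨F, hF⟩ (fun m K => next K (c m)) m
  refine ⟨fun m => (K m).1, antitone_nat_of_succ_le fun m => hnext (K m) (c m),
    fun m => (K m).2, fun i j hij a b => ?_⟩
  obtain ⟨m, hm⟩ := hc ((i, j), a, b)
  have h := hnext' (K m) (c m)
  rw [hm] at h
  obtain ⟨θ, hθ⟩ := h hij
  refine ⟨m + 1, θ, ?_⟩
  change (next (K m) (c m)).1 ⊆ _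
  rw [hm]
  exact hθ

/-- Balanced bodies can be shrunk towards a line, along which every continuous function becomes
almost a function of a single coordinate. -/
theorem exists_needle (hF : IsBalancedBody A B α β F) (hA : MeasurableSet A) (i₀ : Fin n) :
    ∃ (i : Fin n) (x v : Fin n → ℝ), v i = 1 ∧
      ∀ G : (Fin n → ℝ) → ℝ, Continuous G → ∀ ε > 0, ∃ K, IsBalancedBody A B α β K ∧
        ∀ z ∈ K, |G z - G (x + (z i - x i) • v)| < ε := by
  obtain ⟨K, hKanti, hK, hKcut⟩ := hF.exists_antitone_seq hA i₀
  have hKne : ∀ m, (K m).Nonempty := fun m => by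
    rw [Set.nonempty_iff_ne_empty]
    intro h0
    have := (hK m).volume_pos
    rw [h0] at this
    simp at this
  have hne : (⋂ m, K m).Nonempty :=
    IsCompact.nonempty_iInter_of_sequence_nonempty_isCompact_isClosed K
      (fun m => hKanti m.le_succ) hKne (hK 0).isCompact fun m => (hK m).isCompact.isClosed
  obtain ⟨i, x, v, hv, hline⟩ := exists_line_of_cross_eq_zero i₀ hne
    fun x hx y hy z hz i j hij => by
    refine cross_eq_zero_of_forall_rat_halfPlane (x := (x i, x j)) (y := (y i, y j))
      (z := (z i, z j)) fun a b => ?_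
    obtain ⟨m, θ, hm⟩ := hKcut i j hij a b
    refine ⟨Real.cos θ, Real.sin θ, Real.cos_sq_add_sin_sq θ, ?_⟩
    rintro w (rfl | rfl | rfl)
    · exact hm (Set.mem_iInter.mp hx m)
    · exact hm (Set.mem_iInter.mp hy m)
    · exact hm (Set.mem_iInter.mp hz m)
  refine ⟨i, x, v, hv, fun G hG ε hε => ?_⟩
  have hcont : Continuous fun z => |G z - G (x + (z i - x i) • v)| := by fun_prop
  obtain ⟨m, hm⟩ := exists_subset_nhds_of_isCompact (V := K) hKanti.directed_ge
    (fun m => (hK m).isCompact) (U := {z | |G z - G (x + (z i - x i) • v)| < ε}) fun z hz => by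
      refine (isOpen_lt hcont continuous_const).mem_nhds ?_
      rw [Set.mem_ofPred_eq, ← hline z hz, sub_self, abs_zero]
      exact hε
  exact ⟨K m, hK m, fun z hz => hm hz⟩

end IsBalancedBody

end Needle

lemma exists_polynomial_eval_line {σ : Type*} {P : MvPolynomial σ ℝ} {d : ℕ}
    (hP : P.totalDegree ≤ d) (x v : σ → ℝ) (c : ℝ) :
    ∃ p : Polynomial ℝ, p.natDegree ≤ d ∧
      ∀ t, p.eval t = MvPolynomial.eval (x + (t - c) • v) P := by
  refine ⟨MvPolynomial.aeval (fun j => Polynomial.C (v j) * Polynomial.X +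
    Polynomial.C (x j - c * v j)) P, ?_, fun t => ?_⟩
  · exact (MvPolynomial.aeval_natDegree_le P hP _ fun j =>
      Polynomial.natDegree_linear_le).trans_eq (mul_one d)
  · rw [MvPolynomial.aeval_def, ← Polynomial.coe_evalRingHom, MvPolynomial.eval₂_comp_left,
      ← MvPolynomial.eval₂_id]
    have h1 : (Polynomial.evalRingHom t).comp (algebraMap ℝ (Polynomial ℝ)) = RingHom.id ℝ := by
      ext r; simp
    have h2 : (Polynomial.evalRingHom t ∘ fun j => Polynomial.C (v j) * Polynomial.X +
        Polynomial.C (x j - c * v j)) = x + (t - c) • v := by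
      funext j
      simp only [Function.comp_apply, Polynomial.coe_evalRingHom, Polynomial.eval_add,
        Polynomial.eval_mul, Polynomial.eval_C, Polynomial.eval_X, Pi.add_apply, Pi.smul_apply,
        smul_eq_mul]
      ring
    rw [h1, h2]

/-- The first distribution inequality on `Fin (k + 1) → ℝ`. -/
theorem volume_inter_le_exp_neg {k d : ℕ} (hd : 0 < d) {P : MvPolynomial (Fin (k + 1)) ℝ}
    (hP : P.totalDegree ≤ d) {F : Set (Fin (k + 1) → ℝ)} (hFcomp : IsCompact F)
    (hFconv : Convex ℝ F) (hFvol : volume.real F = 1) {M : ℝ} (hM : 0 < M)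
    (hMdef : volume.real ({x | M ≤ |MvPolynomial.eval x P|} ∩ F) = Real.exp (-1))
    {lam : ℝ} (hlam : 1 < lam) :
    volume.real ({x | (4 * lam) ^ d * M < |MvPolynomial.eval x P|} ∩ F) ≤ Real.exp (-lam) := by
  have hG : Continuous fun x => |MvPolynomial.eval x P| := (MvPolynomial.continuous_eval P).abs
  by_contra! hlt
  obtain ⟨mu, hmu, hmu1, hmulam⟩ : ∃ mu,
      Real.exp (-mu) < volume.real ({x | (4 * lam) ^ d * M < |MvPolynomial.eval x P|} ∩ F) ∧
        1 < mu ∧ mu < lam := by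
    have hc : Continuous fun u : ℝ => Real.exp (-u) := by fun_prop
    have h := (hc.continuousAt (x := lam)).eventually (gt_mem_nhds hlt)
    exact ((h.filter_mono nhdsWithin_le_nhds).and (Ioo_mem_nhdsLT hlam)).exists
  have hF : IsBalancedBody {x | M ≤ |MvPolynomial.eval x P|}
      {x | (4 * lam) ^ d * M < |MvPolynomial.eval x P|} (Real.exp (-1)) (Real.exp (-mu)) F :=
    ⟨hFcomp, hFconv, by rw [hMdef, hFvol, mul_one], by rwa [hFvol, mul_one]⟩
  obtain ⟨i, x, v, -, hneedle⟩ := hF.exists_needle (isClosed_le continuous_const hG).measurableSet 0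
  have hpow : (4 * mu) ^ d < (4 * lam) ^ d :=
    pow_lt_pow_left₀ (by linarith) (by linarith) hd.ne'
  have hmu0 : 0 < (4 * mu) ^ d := pow_pos (by linarith) d
  set ε := ((4 * lam) ^ d - (4 * mu) ^ d) * M / ((4 * mu) ^ d + 1) with hε
  have hε0 : 0 < ε := div_pos (mul_pos (sub_pos.mpr hpow) hM) (by linarith)
  have hε1 : (4 * mu) ^ d * (M + ε) = (4 * lam) ^ d * M - ε := by
    rw [hε]; field_simp; ring
  obtain ⟨K, hK, hclose⟩ := hneedle _ hG ε hε0
  obtain ⟨p, hp, hpe⟩ := exists_polynomial_eval_line hP x v (x i)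
  have hKfin : volume K ≠ ⊤ := hK.isCompact.measure_lt_top.ne
  have hf := isLogConcaveProfile_coordSlice hK.isCompact hK.convex i
  have hint : ∫ u, volume.real (coordSlice i K u) = volume.real K := by
    have h := integral_coordSlice hK.isCompact i MeasurableSet.univ
    rw [setIntegral_univ] at h
    rw [← h]; simp
  have hmeas : ∀ c, MeasurableSet {u | c ≤ |p.eval u|} := fun c =>
    (isClosed_le continuous_const p.continuous.abs).measurableSet
  have key := hf.setIntegral_le_rpow (by rw [hint]; exact hK.volume_pos) hp hd
    (M := M + ε) (by linarith) hmu1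
  rw [hint, ← integral_coordSlice hK.isCompact i (hmeas _),
    ← integral_coordSlice hK.isCompact i (hmeas _)] at key
  have h1 : volume.real (K ∩ {z | z i ∈ {u | M + ε ≤ |p.eval u|}}) ≤
      Real.exp (-1) * volume.real K := by
    rw [← hK.volume_inter_eq]
    refine measureReal_mono ?_ ((measure_mono Set.inter_subset_right).trans_lt
      hK.isCompact.measure_lt_top).ne
    rintro z ⟨hzK, hz⟩
    rw [Set.mem_ofPred_eq, Set.mem_ofPred_eq, hpe] at hz
    have h := abs_lt.mp (hclose z hzK)
    refine ⟨?_, hzK⟩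
    rw [Set.mem_ofPred_eq]
    linarith [h.1]
  have h2 : volume.real ({x | (4 * lam) ^ d * M < |MvPolynomial.eval x P|} ∩ K) ≤
      volume.real (K ∩ {z | z i ∈ {u | (4 * mu) ^ d * (M + ε) ≤ |p.eval u|}}) := by
    refine measureReal_mono ?_ ((measure_mono Set.inter_subset_left).trans_lt
      hK.isCompact.measure_lt_top).ne
    rintro z ⟨hz, hzK⟩
    rw [Set.mem_ofPred_eq] at hz
    have h := abs_lt.mp (hclose z hzK)
    refine ⟨hzK, ?_⟩
    rw [Set.mem_ofPred_eq, Set.mem_ofPred_eq, hpe, hε1]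
    linarith [h.2]
  have h3 : (volume.real (K ∩ {z | z i ∈ {u | M + ε ≤ |p.eval u|}}) / volume.real K) ^ mu ≤
      Real.exp (-mu) := by
    rw [neg_eq_neg_one_mul, Real.exp_mul]
    refine Real.rpow_le_rpow (div_nonneg measureReal_nonneg measureReal_nonneg) ?_ (by linarith)
    rwa [div_le_iff₀ hK.volume_pos]
  have h4 := mul_le_mul_of_nonneg_left h3 hK.volume_pos.le
  linarith [hK.lt_volume_inter]

/-- First distribution inequality:
`Vol{x ∈ F : |P(x)| > (4λ)^d M(P)} ≤ e^{-λ}` for all `λ > 1`. -/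
theorem first_distribution_inequality {n : ℕ} (d : ℕ) (P : MvPolynomial (Fin n) ℝ)
    (hPd : P.totalDegree ≤ d) (hPnc : ∀ c : ℝ, P ≠ MvPolynomial.C c)
    (F : Set (EuclideanSpace ℝ (Fin n))) (hFcomp : IsCompact F) (hFconv : Convex ℝ F)
    (hFvol : volume F = 1)
    (M : ℝ) (hM : 0 < M)
    (hMdef : volume {x ∈ F | M ≤ |MvPolynomial.eval (fun i => x i) P|} =
      ENNReal.ofReal (Real.exp (-1)))
    (lam : ℝ) (hlam : 1 < lam) :
    (volume {x ∈ F | (4 * lam) ^ d * M < |MvPolynomial.eval (fun i => x i) P|}).toReal ≤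
      Real.exp (-lam) := by
  have hd : 0 < d := by
    refine Nat.pos_of_ne_zero fun h0 => ?_
    rw [h0, Nat.le_zero] at hPd
    exact hPnc _ (MvPolynomial.totalDegree_eq_zero_iff_eq_C.mp hPd)
  obtain ⟨k, rfl⟩ : ∃ k, n = k + 1 := by
    refine Nat.exists_eq_succ_of_ne_zero ?_
    rintro rfl
    exact hPnc _ (MvPolynomial.eq_C_of_isEmpty P)
  have hpre : ∀ S : Set (EuclideanSpace ℝ (Fin (k + 1))),
      volume (WithLp.toLp 2 ⁻¹' S : Set (Fin (k + 1) → ℝ)) = volume S := fun S =>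
    (PiLp.volume_preserving_toLp (Fin (k + 1))).measure_preimage_equiv
      (f := MeasurableEquiv.toLp 2 (Fin (k + 1) → ℝ)) S
  have himg : (WithLp.toLp 2 ⁻¹' F : Set (Fin (k + 1) → ℝ)) = WithLp.ofLp '' F := by
    ext y
    exact ⟨fun hy => ⟨_, hy, rfl⟩, by rintro ⟨z, hz, rfl⟩; exact hz⟩
  have hcomp : IsCompact (WithLp.toLp 2 ⁻¹' F : Set (Fin (k + 1) → ℝ)) := by
    rw [himg]
    exact hFcomp.image (PiLp.continuous_ofLp 2 _)
  have hconv : Convex ℝ (WithLp.toLp 2 ⁻¹' F : Set (Fin (k + 1) → ℝ)) :=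
    hFconv.linear_preimage (WithLp.linearEquiv 2 ℝ (Fin (k + 1) → ℝ)).symm.toLinearMap
  have h := volume_inter_le_exp_neg hd hPd hcomp hconv
    (by rw [measureReal_def, hpre, hFvol, ENNReal.toReal_one]) hM (by
      rw [measureReal_def, Set.inter_comm]
      refine (congrArg ENNReal.toReal ((hpre _).trans hMdef)).trans ?_
      exact ENNReal.toReal_ofReal (Real.exp_pos _).le) hlam
  rw [measureReal_def, Set.inter_comm] at h
  refine le_of_eq_of_le (congrArg ENNReal.toReal ?_) h
  exact (hpre _).symm
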